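/- (Derivative of the interpolating free entropy) In the setting of the interpolation with path R(·,ε) continuously differentiable and derivatives R'_u, R'_v uniformly bounded in (t,ε) ∈ [0,1]×[0,∞)², the derivative of the average interpolating free entropy satisfies, for all (t,ε), f'ₙ(t,ε) = −(α_u α_v/2) E⟨ (Q_u − R'_u(t,ε))(Q_v − R'_v(t,ε)) ⟩_{t,ε} + (α_u α_v/2) R'_u(t,ε) R'_v(t,ε) + oₙ(1), where oₙ(1) is a quantity vanishing uniformly in (t,ε) as n → ∞; more precisely, f'ₙ(t,ε) = −(1/2)(n_u/n)(n_v/n) E⟨Q_u Q_v⟩_{t,ε} + (n_u/n)(α_v R'_v(t,ε)/2) E⟨Q_u⟩_{t,ε} + (n_v/n)(α_u R'_u(t,ε)/2) E⟨Q_v⟩_{t,ε}. -/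

import Mathlib

open MeasureTheory Real Filter Set

noncomputable section

/-- i.i.d. standard Gaussian measure on `Fin n → ℝ`. -/
def stdGaussian (n : ℕ) : Measure (Fin n → ℝ) :=
  Measure.pi fun _ : Fin n => ProbabilityTheory.gaussianReal 0 1

/-- i.i.d. standard Gaussian measure on matrices `Fin p → Fin q → ℝ`. -/
def stdGaussianMat (p q : ℕ) : Measure (Fin p → Fin q → ℝ) :=
  Measure.pi fun _ : Fin p => stdGaussian q

/-- `P` is the uniform (rotation-invariant) probability measure on the sphere of
radius `r` centered at the origin in `ℝⁿ`. -/
def IsUniformSphere (n : ℕ) (r : ℝ) (P : Measure (Fin n → ℝ)) : Prop :=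
  IsProbabilityMeasure P ∧
  (∀ᵐ x ∂P, ∑ i, (x i) ^ 2 = r ^ 2) ∧
  ∀ O : Matrix (Fin n) (Fin n) ℝ, O ∈ Matrix.orthogonalGroup (Fin n) ℝ →
    P.map (fun x => O.mulVec x) = P

/-- The interpolating Hamiltonian `H_{t,R}(u,v)`, with the observations
`Y^{(t)} = √((1−t)/n) U Vᵀ + Z`, `Ỹ = √(α_v R_v) U + Z̃`, `Ȳ = √(α_u R_u) V + Z̄`
substituted. -/
def interpH (n nu nv : ℕ) (au av t Ru Rv : ℝ)
    (U : Fin nu → ℝ) (V : Fin nv → ℝ) (Z : Fin nu → Fin nv → ℝ)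
    (Zt : Fin nu → ℝ) (Zb : Fin nv → ℝ)
    (u : Fin nu → ℝ) (v : Fin nv → ℝ) : ℝ :=
  (∑ i, ∑ j, ((1 - t) / (2 * n) * (u i) ^ 2 * (v j) ^ 2
      - Real.sqrt ((1 - t) / n) * u i * v j
          * (Real.sqrt ((1 - t) / n) * U i * V j + Z i j)))
  + (∑ i, (av * Rv / 2 * (u i) ^ 2
      - Real.sqrt (av * Rv) * u i * (Real.sqrt (av * Rv) * U i + Zt i)))
  + (∑ j, (au * Ru / 2 * (v j) ^ 2
      - Real.sqrt (au * Ru) * v j * (Real.sqrt (au * Ru) * V j + Zb j)))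

/-- The partition function `Z_{t,R} = ∫∫ e^{−H_{t,R}(u,v)} dP_u(u) dP_v(v)`. -/
def partFun (n nu nv : ℕ) (au av t Ru Rv : ℝ)
    (Pu : Measure (Fin nu → ℝ)) (Pv : Measure (Fin nv → ℝ))
    (U : Fin nu → ℝ) (V : Fin nv → ℝ) (Z : Fin nu → Fin nv → ℝ)
    (Zt : Fin nu → ℝ) (Zb : Fin nv → ℝ) : ℝ :=
  ∫ u, (∫ v, Real.exp (-(interpH n nu nv au av t Ru Rv U V Z Zt Zb u v)) ∂Pv) ∂Pu

/-- The Gibbs bracket `⟨f⟩_{t,R}`, i.e. the expectation of `f(u,v)` under the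
posterior measure proportional to `e^{−H_{t,R}(u,v)} dP_u(u) dP_v(v)`. -/
def gibbs (n nu nv : ℕ) (au av t Ru Rv : ℝ)
    (Pu : Measure (Fin nu → ℝ)) (Pv : Measure (Fin nv → ℝ))
    (U : Fin nu → ℝ) (V : Fin nv → ℝ) (Z : Fin nu → Fin nv → ℝ)
    (Zt : Fin nu → ℝ) (Zb : Fin nv → ℝ)
    (f : (Fin nu → ℝ) → (Fin nv → ℝ) → ℝ) : ℝ :=
  (∫ u, (∫ v, f u v * Real.exp (-(interpH n nu nv au av t Ru Rv U V Z Zt Zb u v)) ∂Pv) ∂Pu)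
    / partFun n nu nv au av t Ru Rv Pu Pv U V Z Zt Zb

/-- Expectation `E` over all the randomness `U ~ P_u`, `V ~ P_v` and the independent
standard Gaussian noises `Z, Z̃, Z̄`. -/
def Efull (nu nv : ℕ)
    (Pu : Measure (Fin nu → ℝ)) (Pv : Measure (Fin nv → ℝ))
    (g : (Fin nu → ℝ) → (Fin nv → ℝ) → (Fin nu → Fin nv → ℝ) →
      (Fin nu → ℝ) → (Fin nv → ℝ) → ℝ) : ℝ :=
  ∫ U, (∫ V, (∫ Z, (∫ Zt, (∫ Zb, g U V Z Zt Zb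
    ∂(stdGaussian nv)) ∂(stdGaussian nu)) ∂(stdGaussianMat nu nv)) ∂Pv) ∂Pu

/-- The average interpolating free entropy `fₙ(t,R) = (1/n) E ln Z_{t,R}`. -/
def interpFreeEntropy (n nu nv : ℕ) (au av t Ru Rv : ℝ)
    (Pu : Measure (Fin nu → ℝ)) (Pv : Measure (Fin nv → ℝ)) : ℝ :=
  (1 / (n : ℝ)) * Efull nu nv Pu Pv (fun U V Z Zt Zb =>
    Real.log (partFun n nu nv au av t Ru Rv Pu Pv U V Z Zt Zb))

/-- The overlap `Q_u = (1/n_u) Σ_i u_i U_i`. -/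
def overlapU (nu : ℕ) (u U : Fin nu → ℝ) : ℝ := (1 / (nu : ℝ)) * ∑ i, u i * U i

/-- The overlap `Q_v = (1/n_v) Σ_j v_j V_j`. -/
def overlapV (nv : ℕ) (v V : Fin nv → ℝ) : ℝ := (1 / (nv : ℝ)) * ∑ j, v j * V j

/-- `E⟨Q_v⟩_{t,R}`. -/
def eQv (n nu nv : ℕ) (au av t Ru Rv : ℝ)
    (Pu : Measure (Fin nu → ℝ)) (Pv : Measure (Fin nv → ℝ)) : ℝ :=
  Efull nu nv Pu Pv (fun U V Z Zt Zb =>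
    gibbs n nu nv au av t Ru Rv Pu Pv U V Z Zt Zb (fun _ v => overlapV nv v V))

/-- `E⟨Q_u⟩_{t,R}`. -/
def eQu (n nu nv : ℕ) (au av t Ru Rv : ℝ)
    (Pu : Measure (Fin nu → ℝ)) (Pv : Measure (Fin nv → ℝ)) : ℝ :=
  Efull nu nv Pu Pv (fun U V Z Zt Zb =>
    gibbs n nu nv au av t Ru Rv Pu Pv U V Z Zt Zb (fun u _ => overlapU nu u U))

/-- The quantity `𝓛 = (1/n) Σ_j [(α_u/2)v_j² − α_u v_j V_j − (1/2)√(α_u/R_u) v_j Z̄_j]`. -/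
def calL (n nv : ℕ) (au Ru : ℝ) (v V Zb : Fin nv → ℝ) : ℝ :=
  (1 / (n : ℝ)) * ∑ j, (au / 2 * (v j) ^ 2 - au * v j * V j
    - 1 / 2 * Real.sqrt (au / Ru) * v j * Zb j)

/-- `E⟨𝓛⟩_{t,R}`. -/
def eL (n nu nv : ℕ) (au av t Ru Rv : ℝ)
    (Pu : Measure (Fin nu → ℝ)) (Pv : Measure (Fin nv → ℝ)) : ℝ :=
  Efull nu nv Pu Pv (fun U V Z Zt Zb =>
    gibbs n nu nv au av t Ru Rv Pu Pv U V Z Zt Zb (fun _ v => calL n nv au Ru v V Zb))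

/-- `φ₀(m) = (m − ln(1+m))/2`. -/
def phi0 (m : ℝ) : ℝ := (m - Real.log (1 + m)) / 2

/-- `E⟨Q_u Q_v⟩_{t,R}`. -/
def eQuQv (n nu nv : ℕ) (au av t Ru Rv : ℝ)
    (Pu : Measure (Fin nu → ℝ)) (Pv : Measure (Fin nv → ℝ)) : ℝ :=
  Efull nu nv Pu Pv (fun U V Z Zt Zb =>
    gibbs n nu nv au av t Ru Rv Pu Pv U V Z Zt Zb
      (fun u v => overlapU nu u U * overlapV nv v V))

/-- `E⟨(Q_u − a)(Q_v − b)⟩_{t,R}`. -/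
def eCross (n nu nv : ℕ) (au av t Ru Rv a b : ℝ)
    (Pu : Measure (Fin nu → ℝ)) (Pv : Measure (Fin nv → ℝ)) : ℝ :=
  Efull nu nv Pu Pv (fun U V Z Zt Zb =>
    gibbs n nu nv au av t Ru Rv Pu Pv U V Z Zt Zb
      (fun u v => (overlapU nu u U - a) * (overlapV nv v V - b)))

section GaussianPi

variable {ι : Type*} [Fintype ι]

/-- The law of a family of i.i.d. standard Gaussian variables indexed by `ι`. -/
abbrev gaussianPi (ι : Type*) [Fintype ι] : Measure (ι → ℝ) :=
  Measure.pi fun _ : ι => ProbabilityTheory.gaussianReal 0 1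

lemma gaussianReal_eq_withDensity_exp (a : ℝ) :
    ProbabilityTheory.gaussianReal a 1 =
      (ProbabilityTheory.gaussianReal 0 1).withDensity
        (fun y => ENNReal.ofReal (exp (a * y - a ^ 2 / 2))) := by
  rw [ProbabilityTheory.gaussianReal_of_var_ne_zero _ one_ne_zero,
    ProbabilityTheory.gaussianReal_of_var_ne_zero _ one_ne_zero,
    ← withDensity_mul _ (by fun_prop) (by fun_prop)]
  congr 1
  ext y
  simp only [Pi.mul_apply, ProbabilityTheory.gaussianPDF, ProbabilityTheory.gaussianPDFReal]
  rw [← ENNReal.ofReal_mul (by positivity), mul_assoc (√_)⁻¹, ← Real.exp_add]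
  congr 3
  push_cast
  ring

lemma integrable_exp_mul_abs_gaussianReal (c : ℝ) :
    Integrable (fun y => exp (c * |y|)) (ProbabilityTheory.gaussianReal 0 1) := by
  refine Integrable.mono' ((ProbabilityTheory.integrable_exp_mul_gaussianReal c).add
    (ProbabilityTheory.integrable_exp_mul_gaussianReal (-c))) (by fun_prop) (.of_forall fun y => ?_)
  rw [Real.norm_eq_abs, Real.abs_exp]
  rcases abs_cases y with ⟨h, _⟩ | ⟨h, _⟩ <;> rw [h] <;> simp only [Pi.add_apply, mul_neg, neg_mul]
  · linarith [Real.exp_pos (-(c * y))]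
  · linarith [Real.exp_pos (c * y)]

lemma integrable_exp_sum_abs_gaussianPi (c : ι → ℝ) :
    Integrable (fun y : ι → ℝ => exp (∑ k, c k * |y k|)) (gaussianPi ι) := by
  simp_rw [Real.exp_sum]
  exact Integrable.fintype_prod (f := fun k y => exp (c k * |y|))
    fun k => integrable_exp_mul_abs_gaussianReal (c k)

lemma gaussianPi_map_add (a : ι → ℝ) :
    (gaussianPi ι).map (fun z => z + a) =
      (gaussianPi ι).withDensity
        (fun y => ENNReal.ofReal (exp (∑ k, (a k * y k - a k ^ 2 / 2)))) := by
  have h1 : (gaussianPi ι).map (fun z => z + a)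
      = Measure.pi fun k => ProbabilityTheory.gaussianReal (a k) 1 := by
    have h := Measure.pi_map_pi (μ := fun _ : ι => ProbabilityTheory.gaussianReal 0 1)
      (f := fun k (x : ℝ) => x + a k) (fun k => by fun_prop)
    simp only [ProbabilityTheory.gaussianReal_map_add_const, zero_add] at h
    exact h
  rw [h1]
  refine Measure.pi_eq fun S hS => ?_
  have hint : ∀ k, Integrable (fun y : ℝ => exp (a k * y - a k ^ 2 / 2))
      ((ProbabilityTheory.gaussianReal 0 1).restrict (S k)) := fun k => by
    simp_rw [sub_eq_add_neg, Real.exp_add]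
    exact ((ProbabilityTheory.integrable_exp_mul_gaussianReal (a k)).mul_const _).restrict
  rw [withDensity_apply _ (MeasurableSet.univ_pi hS), Measure.restrict_pi_pi]
  simp_rw [Real.exp_sum]
  rw [← ofReal_integral_eq_lintegral_ofReal
    (Integrable.fintype_prod (f := fun k y => exp (a k * y - a k ^ 2 / 2)) hint)
    (.of_forall fun y => by positivity),
    integral_fintype_prod_eq_prod (f := fun k y => exp (a k * y - a k ^ 2 / 2)),
    ENNReal.ofReal_prod_of_nonneg (fun k _ => by positivity)]
  refine Finset.prod_congr rfl fun k _ => ?_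
  rw [gaussianReal_eq_withDensity_exp (a k), withDensity_apply _ (hS k),
    ofReal_integral_eq_lintegral_ofReal (hint k) (.of_forall fun y => by positivity)]

/-- The Cameron–Martin formula for i.i.d. standard Gaussian variables. -/
lemma integral_add_gaussianPi (a : ι → ℝ) {h : (ι → ℝ) → ℝ} (hh : Measurable h) :
    ∫ z, h (z + a) ∂(gaussianPi ι) =
      ∫ y, exp (∑ k, (a k * y k - a k ^ 2 / 2)) * h y ∂(gaussianPi ι) := by
  rw [← integral_map (φ := fun z => z + a) (by fun_prop) hh.aestronglyMeasurable,
    gaussianPi_map_add, integral_withDensity_eq_integral_toReal_smul (by fun_prop) (by simp)]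
  simp [ENNReal.toReal_ofReal, Real.exp_nonneg]

lemma integrable_abs_eval_gaussianPi (k : ι) :
    Integrable (fun z : ι → ℝ => |z k|) (gaussianPi ι) := by
  have h : Integrable id (ProbabilityTheory.gaussianReal 0 1) :=
    memLp_one_iff_integrable.1 (by exact_mod_cast ProbabilityTheory.memLp_id_gaussianReal 1)
  exact (integrable_eval (μ := fun _ : ι => ProbabilityTheory.gaussianReal 0 1) (i := k) h).abs

/-- Gaussian integration by parts, for a function that is bounded together with its partial
derivative. -/
lemma integral_eval_mul_gaussianPi [DecidableEq ι] (k : ι) {m m' : (ι → ℝ) → ℝ} {A A' : ℝ}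
    (hm : Measurable m) (hm' : Measurable m') (hA : ∀ z, |m z| ≤ A) (hA' : ∀ z, |m' z| ≤ A')
    (hd : ∀ z τ, HasDerivAt (fun τ : ℝ => m (z + τ • Pi.single k 1))
      (m' (z + τ • Pi.single k 1)) τ) :
    ∫ z, z k * m z ∂(gaussianPi ι) = ∫ z, m' z ∂(gaussianPi ι) := by
  have hA0 : 0 ≤ A := (abs_nonneg _).trans (hA 0)
  have hCM : ∀ τ : ℝ, ∫ z, m (z + τ • Pi.single k 1) ∂(gaussianPi ι)
      = ∫ z, exp (τ * z k - τ ^ 2 / 2) * m z ∂(gaussianPi ι) := fun τ => by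
    rw [integral_add_gaussianPi _ hm]
    congr 1
    ext z
    rw [Finset.sum_eq_single k] <;> simp +contextual
  have h1 := (hasDerivAt_integral_of_dominated_loc_of_deriv_le (μ := gaussianPi ι) (x₀ := (0:ℝ))
    (s := univ) (F := fun τ z => m (z + τ • Pi.single k 1))
    (F' := fun τ z => m' (z + τ • Pi.single k 1)) (bound := fun _ => A') univ_mem
    (.of_forall fun τ => (hm.comp (by fun_prop)).aestronglyMeasurable)
    (Integrable.of_bound (hm.comp (by fun_prop)).aestronglyMeasurable A (.of_forall fun z => hA _))
    (hm'.comp (by fun_prop)).aestronglyMeasurable (.of_forall fun z τ _ => hA' _)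
    (integrable_const _) (.of_forall fun z τ _ => hd z τ)).2
  have hint : Integrable (fun z : ι → ℝ => exp (2 * |z k|) * A) (gaussianPi ι) :=
    (integrable_comp_eval (μ := fun _ : ι => ProbabilityTheory.gaussianReal 0 1) (i := k)
      (integrable_exp_mul_abs_gaussianReal 2)).mul_const _
  have h2 := (hasDerivAt_integral_of_dominated_loc_of_deriv_le (μ := gaussianPi ι) (x₀ := (0:ℝ))
    (s := Metric.ball 0 1) (F := fun τ z => exp (τ * z k - τ ^ 2 / 2) * m z)
    (F' := fun τ z => exp (τ * z k - τ ^ 2 / 2) * (z k - τ) * m z)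
    (bound := fun z => exp (2 * |z k|) * A) (Metric.ball_mem_nhds _ one_pos)
    (.of_forall fun τ => by fun_prop)
    (Integrable.of_bound (by fun_prop) A (.of_forall fun z => by simpa using hA z))
    (by fun_prop) (.of_forall fun z τ hτ => ?_) hint (.of_forall fun z τ _ => ?_)).2
  · simp_rw [hCM] at h1
    have h3 := h2.unique h1
    simpa using h3
  · rw [Metric.mem_ball, dist_zero_right, Real.norm_eq_abs] at hτ
    rw [norm_mul, norm_mul, Real.norm_eq_abs, Real.abs_exp, Real.norm_eq_abs, Real.norm_eq_abs]
    gcongr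
    · have e1 : exp (τ * z k - τ ^ 2 / 2) ≤ exp |z k| := by
        apply Real.exp_le_exp.2
        have := abs_mul τ (z k) ▸ le_abs_self (τ * z k)
        nlinarith [abs_nonneg (z k), sq_nonneg τ]
      have e2 : |z k - τ| ≤ exp |z k| := by
        have := abs_sub (z k) τ
        have := Real.add_one_le_exp |z k|
        linarith
      calc _ ≤ exp |z k| * exp |z k| := by gcongr
        _ = _ := by rw [← Real.exp_add]; ring_nf
    · exact hA z
  · have : HasDerivAt (fun τ : ℝ => τ * z k - τ ^ 2 / 2) (z k - τ) τ := by
      refine (((hasDerivAt_id τ).mul_const (z k)).sub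
        ((hasDerivAt_pow 2 τ).div_const 2)).congr_deriv ?_
      simp
    exact this.exp.mul_const _

end GaussianPi

section Channel

variable {Ω ι : Type*} [MeasurableSpace Ω] [Fintype ι]

/-- Log-likelihood ratio of the signal `x` in the Gaussian channel `y = s x + z`. -/
def chanExp (s x y : ι → ℝ) : ℝ := ∑ k, (s k * x k * y k - s k ^ 2 * x k ^ 2 / 2)

/-- Derivative of `chanExp` at `(s, y)` in the direction `(d, e)`. -/
def chanExpDir (s d y e x : ι → ℝ) : ℝ :=
  ∑ k, (d k * x k * y k + s k * x k * e k - s k * d k * x k ^ 2)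

/-- Partition function of the Gaussian channel with signal `X` and observation `y`. -/
def chanZ (μ : Measure Ω) (X : Ω → ι → ℝ) (s y : ι → ℝ) : ℝ :=
  ∫ ω, exp (chanExp s (X ω) y) ∂μ

/-- Unnormalized posterior expectation of `φ`. -/
def chanNum (μ : Measure Ω) (X : Ω → ι → ℝ) (φ : Ω → ℝ) (s y : ι → ℝ) : ℝ :=
  ∫ ω, φ ω * exp (chanExp s (X ω) y) ∂μ

/-- Posterior expectation of `φ`. -/
def chanAvg (μ : Measure Ω) (X : Ω → ι → ℝ) (φ : Ω → ℝ) (s y : ι → ℝ) : ℝ :=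
  chanNum μ X φ s y / chanZ μ X s y

/-- Bound on `chanExp` for signals with coordinates in `[-C, C]`. -/
def chanBound (C : ℝ) (s y : ι → ℝ) : ℝ := ∑ k, (|s k| * C * |y k| + s k ^ 2 * C ^ 2 / 2)

/-- Bound on `chanExpDir` for signals with coordinates in `[-C, C]`. -/
def chanDirBound (C : ℝ) (s d y e : ι → ℝ) : ℝ :=
  ∑ k, (|d k| * C * |y k| + |s k| * C * |e k| + |s k| * |d k| * C ^ 2)

lemma abs_chanExp_le {C : ℝ} {x : ι → ℝ} (hx : ∀ k, |x k| ≤ C) (s y : ι → ℝ) :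
    |chanExp s x y| ≤ chanBound C s y := by
  refine (Finset.abs_sum_le_sum_abs _ _).trans (Finset.sum_le_sum fun k _ => ?_)
  have h2 : x k ^ 2 ≤ C ^ 2 := sq_abs (x k) ▸ pow_le_pow_left₀ (abs_nonneg _) (hx k) 2
  refine (abs_sub _ _).trans ?_
  rw [abs_mul, abs_mul, abs_of_nonneg (by positivity : 0 ≤ s k ^ 2 * x k ^ 2 / 2)]
  gcongr
  exact hx k

lemma abs_chanExpDir_le {C : ℝ} {x : ι → ℝ} (hx : ∀ k, |x k| ≤ C) (s d y e : ι → ℝ) :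
    |chanExpDir s d y e x| ≤ chanDirBound C s d y e := by
  refine (Finset.abs_sum_le_sum_abs _ _).trans (Finset.sum_le_sum fun k _ => ?_)
  have h2 : x k ^ 2 ≤ C ^ 2 := sq_abs (x k) ▸ pow_le_pow_left₀ (abs_nonneg _) (hx k) 2
  refine (abs_sub _ _).trans (add_le_add ((abs_add_le _ _).trans (add_le_add ?_ ?_)) ?_)
  · rw [abs_mul, abs_mul]; gcongr; exact hx k
  · rw [abs_mul, abs_mul]; gcongr; exact hx k
  · rw [abs_mul, abs_mul, abs_of_nonneg (sq_nonneg (x k))]; gcongr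

lemma continuous_chanBound (C : ℝ) :
    Continuous fun p : (ι → ℝ) × (ι → ℝ) => chanBound C p.1 p.2 := by
  unfold chanBound; fun_prop

lemma hasDerivAt_chanExp (s d x y e : ι → ℝ) (θ : ℝ) :
    HasDerivAt (fun θ : ℝ => chanExp (s + θ • d) x (y + θ • e))
      (chanExpDir (s + θ • d) d (y + θ • e) e x) θ := by
  unfold chanExp chanExpDir
  refine HasDerivAt.fun_sum fun k _ => ?_
  have hs : HasDerivAt (fun θ : ℝ => (s + θ • d) k) (d k) θ := by
    simpa using ((hasDerivAt_id θ).mul_const (d k)).const_add (s k)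
  have hy : HasDerivAt (fun θ : ℝ => (y + θ • e) k) (e k) θ := by
    simpa using ((hasDerivAt_id θ).mul_const (e k)).const_add (y k)
  refine (((hs.mul_const (x k)).mul hy).sub
    (((hs.pow 2).mul_const (x k ^ 2)).div_const 2)).congr_deriv ?_
  simp only [Nat.cast_ofNat]
  ring

variable {μ : Measure Ω} {X : Ω → ι → ℝ}

lemma chanNum_one (s y : ι → ℝ) : chanNum μ X (fun _ => 1) s y = chanZ μ X s y := by
  simp [chanNum, chanZ]

variable [IsProbabilityMeasure μ] {C : ℝ}

lemma measurable_chanExp_signal (hX : Measurable X) (s y : ι → ℝ) :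
    Measurable fun ω => chanExp s (X ω) y := by
  unfold chanExp
  have := fun k => (measurable_pi_apply k).comp hX
  simp only [Function.comp_def] at this
  fun_prop

lemma measurable_chanExpDir_signal (hX : Measurable X) (s d y e : ι → ℝ) :
    Measurable fun ω => chanExpDir s d y e (X ω) := by
  unfold chanExpDir
  have := fun k => (measurable_pi_apply k).comp hX
  simp only [Function.comp_def] at this
  fun_prop

lemma norm_mul_exp_le {a A b B : ℝ} (ha : |a| ≤ A) (hb : |b| ≤ B) :
    ‖a * exp b‖ ≤ A * exp B := by
  rw [norm_mul, Real.norm_eq_abs, Real.norm_eq_abs, Real.abs_exp]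
  have := (abs_nonneg a).trans ha
  gcongr
  exact (le_abs_self b).trans hb

lemma integrable_chanNum (hX : Measurable X) (hC : ∀ᵐ ω ∂μ, ∀ k, |X ω k| ≤ C) {φ : Ω → ℝ}
    (hφ : Measurable φ) {A : ℝ} (hA : ∀ᵐ ω ∂μ, |φ ω| ≤ A) (s y : ι → ℝ) :
    Integrable (fun ω => φ ω * exp (chanExp s (X ω) y)) μ := by
  have := measurable_chanExp_signal hX s y
  refine Integrable.of_bound (by fun_prop) (A * exp (chanBound C s y)) ?_
  filter_upwards [hC, hA] with ω h1 h2
  exact norm_mul_exp_le h2 (abs_chanExp_le h1 s y)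

lemma continuous_chanNum (hX : Measurable X) (hC : ∀ᵐ ω ∂μ, ∀ k, |X ω k| ≤ C) {φ : Ω → ℝ}
    (hφ : Measurable φ) {A : ℝ} (hA : ∀ᵐ ω ∂μ, |φ ω| ≤ A) :
    Continuous fun p : (ι → ℝ) × (ι → ℝ) => chanNum μ X φ p.1 p.2 := by
  rw [continuous_iff_continuousAt]
  intro p
  refine continuousAt_of_dominated (bound := fun _ => A * exp (chanBound C p.1 p.2 + 1))
    (.of_forall fun q => (integrable_chanNum hX hC hφ hA q.1 q.2).aestronglyMeasurable) ?_
    (integrable_const _) (.of_forall fun ω => ?_)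
  · filter_upwards [(continuous_chanBound C).continuousAt.eventually_lt continuousAt_const
      (lt_add_one (chanBound C p.1 p.2))] with q hq
    filter_upwards [hC, hA] with ω h1 h2
    exact norm_mul_exp_le h2 ((abs_chanExp_le h1 q.1 q.2).trans hq.le)
  · have : Continuous fun q : (ι → ℝ) × (ι → ℝ) => chanExp q.1 (X ω) q.2 := by
      unfold chanExp; fun_prop
    fun_prop

lemma exp_neg_le_chanZ (hX : Measurable X) (hC : ∀ᵐ ω ∂μ, ∀ k, |X ω k| ≤ C) (s y : ι → ℝ) :
    exp (-chanBound C s y) ≤ chanZ μ X s y := by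
  have h := integrable_chanNum (φ := fun _ => 1) (A := 1) hX hC (by fun_prop) (by simp) s y
  have := integral_mono_ae (μ := μ) (integrable_const (exp (-chanBound C s y))) h (by
    filter_upwards [hC] with ω h1
    simp only [one_mul, Real.exp_le_exp]
    exact (abs_le.1 (abs_chanExp_le h1 s y)).1)
  simpa [chanZ] using this

lemma chanZ_pos (hX : Measurable X) (hC : ∀ᵐ ω ∂μ, ∀ k, |X ω k| ≤ C) (s y : ι → ℝ) :
    0 < chanZ μ X s y := (Real.exp_pos _).trans_le (exp_neg_le_chanZ hX hC s y)

lemma abs_chanNum_le (hX : Measurable X) (hC : ∀ᵐ ω ∂μ, ∀ k, |X ω k| ≤ C) {φ : Ω → ℝ}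
    {A : ℝ} (hA : ∀ᵐ ω ∂μ, |φ ω| ≤ A) (s y : ι → ℝ) :
    |chanNum μ X φ s y| ≤ A * chanZ μ X s y := by
  have h := integrable_chanNum (φ := fun _ => 1) (A := 1) hX hC (by fun_prop) (by simp) s y
  simp only [one_mul] at h
  rw [chanZ, ← integral_const_mul]
  refine norm_integral_le_of_norm_le (f := fun ω => φ ω * exp (chanExp s (X ω) y))
    (h.const_mul A) ?_
  filter_upwards [hA] with ω h2
  rw [norm_mul, Real.norm_eq_abs, Real.norm_eq_abs, Real.abs_exp]
  gcongr

lemma chanZ_le (hX : Measurable X) (hC : ∀ᵐ ω ∂μ, ∀ k, |X ω k| ≤ C) (s y : ι → ℝ) :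
    chanZ μ X s y ≤ exp (chanBound C s y) := by
  have h := integrable_chanNum (φ := fun _ => 1) (A := 1) hX hC (by fun_prop) (by simp) s y
  have := integral_mono_ae (μ := μ) h (integrable_const (exp (chanBound C s y))) (by
    filter_upwards [hC] with ω h1
    simp only [one_mul, Real.exp_le_exp]
    exact (abs_le.1 (abs_chanExp_le h1 s y)).2)
  simpa [chanZ] using this

lemma abs_log_chanZ_le (hX : Measurable X) (hC : ∀ᵐ ω ∂μ, ∀ k, |X ω k| ≤ C) (s y : ι → ℝ) :
    |log (chanZ μ X s y)| ≤ chanBound C s y :=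
  abs_le.2 ⟨(Real.le_log_iff_exp_le (chanZ_pos hX hC s y)).2 (exp_neg_le_chanZ hX hC s y),
    (Real.log_le_iff_le_exp (chanZ_pos hX hC s y)).2 (chanZ_le hX hC s y)⟩

lemma abs_chanAvg_le (hX : Measurable X) (hC : ∀ᵐ ω ∂μ, ∀ k, |X ω k| ≤ C) {φ : Ω → ℝ}
    {A : ℝ} (hA : ∀ᵐ ω ∂μ, |φ ω| ≤ A) (s y : ι → ℝ) :
    |chanAvg μ X φ s y| ≤ A := by
  have hZ := chanZ_pos hX hC s y
  rw [chanAvg, abs_div, abs_of_pos hZ, div_le_iff₀ hZ]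
  exact abs_chanNum_le hX hC hA s y

lemma continuous_chanZ (hX : Measurable X) (hC : ∀ᵐ ω ∂μ, ∀ k, |X ω k| ≤ C) :
    Continuous fun p : (ι → ℝ) × (ι → ℝ) => chanZ μ X p.1 p.2 := by
  simp_rw [← chanNum_one]
  exact continuous_chanNum (A := 1) hX hC (by fun_prop) (by simp)

lemma continuous_log_chanZ (hX : Measurable X) (hC : ∀ᵐ ω ∂μ, ∀ k, |X ω k| ≤ C) :
    Continuous fun p : (ι → ℝ) × (ι → ℝ) => log (chanZ μ X p.1 p.2) :=
  (continuous_chanZ hX hC).log fun p => (chanZ_pos hX hC p.1 p.2).ne'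

lemma continuous_chanAvg (hX : Measurable X) (hC : ∀ᵐ ω ∂μ, ∀ k, |X ω k| ≤ C) {φ : Ω → ℝ}
    (hφ : Measurable φ) {A : ℝ} (hA : ∀ᵐ ω ∂μ, |φ ω| ≤ A) :
    Continuous fun p : (ι → ℝ) × (ι → ℝ) => chanAvg μ X φ p.1 p.2 :=
  (continuous_chanNum hX hC hφ hA).div (continuous_chanZ hX hC)
    fun p => (chanZ_pos hX hC p.1 p.2).ne'

lemma hasDerivAt_chanNum (hX : Measurable X) (hC : ∀ᵐ ω ∂μ, ∀ k, |X ω k| ≤ C) {φ : Ω → ℝ}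
    (hφ : Measurable φ) {A : ℝ} (hA : ∀ᵐ ω ∂μ, |φ ω| ≤ A) (s d y e : ι → ℝ) (θ : ℝ) :
    HasDerivAt (fun θ : ℝ => chanNum μ X φ (s + θ • d) (y + θ • e))
      (chanNum μ X (fun ω => φ ω * chanExpDir (s + θ • d) d (y + θ • e) e (X ω))
        (s + θ • d) (y + θ • e)) θ := by
  set B : ℝ → ℝ := fun θ => chanBound C (s + θ • d) (y + θ • e) with hB
  set B' : ℝ → ℝ := fun θ => chanDirBound C (s + θ • d) d (y + θ • e) e with hB'
  have hBc : Continuous B := by simp only [hB, chanBound]; fun_prop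
  have hBc' : Continuous B' := by simp only [hB', chanDirBound]; fun_prop
  have h1 := hBc.continuousAt.eventually_lt continuousAt_const (lt_add_one (B θ))
  have h2 := hBc'.continuousAt.eventually_lt continuousAt_const (lt_add_one (B' θ))
  have hm := measurable_chanExpDir_signal hX (s + θ • d) d (y + θ • e) e
  have hm' := measurable_chanExp_signal hX (s + θ • d) (y + θ • e)
  refine (hasDerivAt_integral_of_dominated_loc_of_deriv_le (μ := μ) (h1.and h2)
    (bound := fun _ => A * (B' θ + 1) * exp (B θ + 1))
    (F' := fun θ ω => (φ ω * chanExpDir (s + θ • d) d (y + θ • e) e (X ω))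
      * exp (chanExp (s + θ • d) (X ω) (y + θ • e)))
    (.of_forall fun t => (integrable_chanNum hX hC hφ hA _ _).aestronglyMeasurable)
    (integrable_chanNum hX hC hφ hA _ _) (by fun_prop) ?_ (integrable_const _)
    (.of_forall fun ω t _ => ?_)).2
  · filter_upwards [hC, hA] with ω hω hω2 t ht
    refine norm_mul_exp_le ?_ ((abs_chanExp_le hω _ _).trans ht.1.le)
    rw [abs_mul]
    have := (abs_nonneg _).trans hω2
    gcongr
    exact (abs_chanExpDir_le hω _ _ _ _).trans ht.2.le
  · refine ((hasDerivAt_chanExp s d (X ω) y e t).exp.const_mul (φ ω)).congr_deriv ?_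
    ring

lemma hasDerivAt_log_chanZ (hX : Measurable X) (hC : ∀ᵐ ω ∂μ, ∀ k, |X ω k| ≤ C)
    (s d y e : ι → ℝ) (θ : ℝ) :
    HasDerivAt (fun θ : ℝ => log (chanZ μ X (s + θ • d) (y + θ • e)))
      (chanAvg μ X (fun ω => chanExpDir (s + θ • d) d (y + θ • e) e (X ω))
        (s + θ • d) (y + θ • e)) θ := by
  have h := hasDerivAt_chanNum (φ := fun _ => 1) (A := 1) hX hC (by fun_prop) (by simp) s d y e θ
  simp_rw [chanNum_one, one_mul] at h
  exact h.log (chanZ_pos hX hC _ _).ne'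

lemma hasDerivAt_chanAvg (hX : Measurable X) (hC : ∀ᵐ ω ∂μ, ∀ k, |X ω k| ≤ C) {φ : Ω → ℝ}
    (hφ : Measurable φ) {A : ℝ} (hA : ∀ᵐ ω ∂μ, |φ ω| ≤ A) (s d y e : ι → ℝ) (θ : ℝ) :
    HasDerivAt (fun θ : ℝ => chanAvg μ X φ (s + θ • d) (y + θ • e))
      (chanAvg μ X (fun ω => φ ω * chanExpDir (s + θ • d) d (y + θ • e) e (X ω))
          (s + θ • d) (y + θ • e)
        - chanAvg μ X φ (s + θ • d) (y + θ • e)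
          * chanAvg μ X (fun ω => chanExpDir (s + θ • d) d (y + θ • e) e (X ω))
            (s + θ • d) (y + θ • e)) θ := by
  have h := hasDerivAt_chanNum (φ := fun _ => 1) (A := 1) hX hC (by fun_prop) (by simp) s d y e θ
  simp_rw [chanNum_one, one_mul] at h
  have hZ := (chanZ_pos hX hC (s + θ • d) (y + θ • e)).ne'
  refine ((hasDerivAt_chanNum hX hC hφ hA s d y e θ).div h hZ).congr_deriv ?_
  simp only [chanAvg]
  field_simp

end Channel

section FreeEntropy

variable {Ω ι : Type*} [MeasurableSpace Ω] [Fintype ι]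

/-- Average free entropy of the Gaussian channel `y = s X + z`. -/
def chanF (μ : Measure Ω) (X : Ω → ι → ℝ) (s : ι → ℝ) : ℝ :=
  ∫ p, log (chanZ μ X s (s * X p.1 + p.2)) ∂(μ.prod (gaussianPi ι))

/-- The correlation `E[X_k ⟨x_k⟩]` between the signal and its posterior mean. -/
def chanG (μ : Measure Ω) (X : Ω → ι → ℝ) (s : ι → ℝ) (k : ι) : ℝ :=
  ∫ p, X p.1 k * chanAvg μ X (fun ω => X ω k) s (s * X p.1 + p.2) ∂(μ.prod (gaussianPi ι))

variable {μ : Measure Ω} [IsProbabilityMeasure μ] {X : Ω → ι → ℝ} {C : ℝ}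

lemma chanAvg_chanExpDir (hX : Measurable X) (hC : ∀ᵐ ω ∂μ, ∀ k, |X ω k| ≤ C)
    (s d y e t w : ι → ℝ) :
    chanAvg μ X (fun ω => chanExpDir s d y e (X ω)) t w =
      ∑ k, ((d k * y k + s k * e k) * chanAvg μ X (fun ω => X ω k) t w
        - s k * d k * chanAvg μ X (fun ω => X ω k ^ 2) t w) := by
  have hXk : ∀ k, Measurable fun ω => X ω k := fun k => (measurable_pi_apply k).comp hX
  have h1 : ∀ k, Integrable (fun ω => X ω k * exp (chanExp t (X ω) w)) μ := fun k =>
    integrable_chanNum hX hC (hXk k) (hC.mono fun ω h => h k) t w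
  have h2 : ∀ k, Integrable (fun ω => X ω k ^ 2 * exp (chanExp t (X ω) w)) μ := fun k =>
    integrable_chanNum hX hC ((hXk k).pow_const 2) (A := C ^ 2) (hC.mono fun ω h => by
      rw [abs_pow]; exact pow_le_pow_left₀ (abs_nonneg _) (h k) 2) t w
  have h3 : chanNum μ X (fun ω => chanExpDir s d y e (X ω)) t w =
      ∑ k, ((d k * y k + s k * e k) * chanNum μ X (fun ω => X ω k) t w
        - s k * d k * chanNum μ X (fun ω => X ω k ^ 2) t w) := by
    simp only [chanNum, ← integral_const_mul]
    simp_rw [← integral_sub ((h1 _).const_mul _) ((h2 _).const_mul _)]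
    have h3 : ∀ k ∈ Finset.univ, Integrable (fun ω =>
        (d k * y k + s k * e k) * (X ω k * exp (chanExp t (X ω) w))
          - s k * d k * (X ω k ^ 2 * exp (chanExp t (X ω) w))) μ := fun k _ =>
      ((h1 k).const_mul _).sub ((h2 k).const_mul _)
    rw [← integral_finsetSum _ h3]
    refine integral_congr_ae (.of_forall fun ω => ?_)
    simp only [chanExpDir, Finset.sum_mul]
    exact Finset.sum_congr rfl fun k _ => by ring
  rw [chanAvg, h3, Finset.sum_div]
  exact Finset.sum_congr rfl fun k _ => by simp only [chanAvg]; ring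

lemma integrable_exp_chanBound (C : ℝ) (s : ι → ℝ) :
    Integrable (fun y => exp (chanBound C s y)) (gaussianPi ι) := by
  simp_rw [chanBound, Finset.sum_add_distrib, Real.exp_add]
  exact (integrable_exp_sum_abs_gaussianPi fun k => |s k| * C).mul_const _

lemma integral_signal_mul_obs (hX : Measurable X) (hC : ∀ᵐ ω ∂μ, ∀ k, |X ω k| ≤ C) {φ : Ω → ℝ}
    (hφ : Measurable φ) {A : ℝ} (hA : ∀ᵐ ω ∂μ, |φ ω| ≤ A) {ψ : (ι → ℝ) → ℝ} (hψ : Measurable ψ)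
    {D : ℝ} (hD : ∀ y, |ψ y| ≤ D) (s : ι → ℝ) :
    ∫ p, φ p.1 * ψ (s * X p.1 + p.2) ∂(μ.prod (gaussianPi ι)) =
      ∫ y, chanNum μ X φ s y * ψ y ∂(gaussianPi ι) := by
  have hA' : ∀ᵐ p ∂(μ.prod (gaussianPi ι)), |φ p.1| ≤ A :=
    Measure.quasiMeasurePreserving_fst.ae hA
  have hC' : ∀ᵐ p ∂(μ.prod (gaussianPi ι)), ∀ k, |X p.1 k| ≤ C :=
    Measure.quasiMeasurePreserving_fst.ae hC
  have hint : Integrable (fun p : Ω × (ι → ℝ) => φ p.1 * ψ (s * X p.1 + p.2))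
      (μ.prod (gaussianPi ι)) := by
    refine Integrable.of_bound (by fun_prop) (A * D) ?_
    filter_upwards [hA'] with p hp
    rw [norm_mul]
    exact mul_le_mul hp (hD _) (norm_nonneg _) ((abs_nonneg _).trans hp)
  have hm : Measurable fun p : Ω × (ι → ℝ) => chanExp s (X p.1) p.2 := by
    have h : Continuous fun q : (ι → ℝ) × (ι → ℝ) => chanExp s q.1 q.2 := by
      unfold chanExp; fun_prop
    exact h.measurable.comp ((hX.comp measurable_fst).prodMk measurable_snd)
  have hint2 : Integrable (Function.uncurry fun (ω : Ω) (y : ι → ℝ) =>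
      φ ω * exp (chanExp s (X ω) y) * ψ y) (μ.prod (gaussianPi ι)) := by
    refine Integrable.mono' (((integrable_exp_chanBound C s).const_mul (A * D)).comp_snd μ)
      ?_ ?_
    · have : Measurable (Function.uncurry fun (ω : Ω) (y : ι → ℝ) =>
        φ ω * exp (chanExp s (X ω) y) * ψ y) :=
        ((hφ.comp measurable_fst).mul hm.exp).mul (hψ.comp measurable_snd)
      exact this.aestronglyMeasurable
    · filter_upwards [hA', hC'] with p hp hp'
      have h0 := (abs_nonneg _).trans hp
      have h1 := norm_mul_exp_le hp (abs_chanExp_le hp' s p.2)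
      simp only [Function.uncurry]
      rw [norm_mul]
      calc _ ≤ A * exp (chanBound C s p.2) * D := by
            gcongr
            exact hD _
        _ = _ := by ring
  rw [integral_prod _ hint]
  simp_rw [chanNum, ← integral_mul_const]
  rw [← integral_integral_swap hint2]
  refine integral_congr_ae (.of_forall fun ω => ?_)
  simp only [integral_const_mul, add_comm (s * X ω)]
  rw [integral_add_gaussianPi _ hψ, ← integral_const_mul]
  refine integral_congr_ae (.of_forall fun y => ?_)
  simp only [chanExp, Pi.mul_apply, mul_pow]
  ring

lemma continuous_chanAvg_obs (hX : Measurable X) (hC : ∀ᵐ ω ∂μ, ∀ k, |X ω k| ≤ C) {φ : Ω → ℝ}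
    (hφ : Measurable φ) {A : ℝ} (hA : ∀ᵐ ω ∂μ, |φ ω| ≤ A) (s : ι → ℝ) :
    Continuous fun y => chanAvg μ X φ s y :=
  (continuous_chanAvg hX hC hφ hA).comp (by fun_prop : Continuous fun y => (s, y))

/-- The Nishimori identity. -/
lemma integral_signal_mul_chanAvg (hX : Measurable X) (hC : ∀ᵐ ω ∂μ, ∀ k, |X ω k| ≤ C)
    {φ : Ω → ℝ} (hφ : Measurable φ) {A : ℝ} (hA : ∀ᵐ ω ∂μ, |φ ω| ≤ A) (s : ι → ℝ) :
    ∫ p, φ p.1 * chanAvg μ X φ s (s * X p.1 + p.2) ∂(μ.prod (gaussianPi ι)) =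
      ∫ p, chanAvg μ X φ s (s * X p.1 + p.2) ^ 2 ∂(μ.prod (gaussianPi ι)) := by
  have hm := (continuous_chanAvg_obs hX hC hφ hA s).measurable
  have h := integral_signal_mul_obs (φ := fun _ => 1) (A := 1) hX hC (by fun_prop) (by simp)
    (ψ := fun y => chanAvg μ X φ s y ^ 2) (hm.pow_const 2) (D := A ^ 2)
    (fun y => by
      rw [abs_pow]
      exact pow_le_pow_left₀ (abs_nonneg _) (abs_chanAvg_le hX hC hA s y) 2) s
  rw [integral_signal_mul_obs hX hC hφ hA hm (abs_chanAvg_le hX hC hA s) s]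
  simp only [one_mul] at h
  rw [h]
  refine integral_congr_ae (.of_forall fun y => ?_)
  have := (chanZ_pos hX hC s y).ne'
  simp only [chanNum_one, chanAvg]
  field_simp

lemma integrable_chanAvg_obs (hX : Measurable X) (hC : ∀ᵐ ω ∂μ, ∀ k, |X ω k| ≤ C) {φ : Ω → ℝ}
    (hφ : Measurable φ) {A : ℝ} (hA : ∀ᵐ ω ∂μ, |φ ω| ≤ A) (s : ι → ℝ) :
    Integrable (fun p : Ω × (ι → ℝ) => chanAvg μ X φ s (s * X p.1 + p.2))
      (μ.prod (gaussianPi ι)) :=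
  Integrable.of_bound ((continuous_chanAvg_obs hX hC hφ hA s).measurable.comp
    (by fun_prop)).aestronglyMeasurable A (.of_forall fun p => abs_chanAvg_le hX hC hA s _)

lemma integrable_signal_mul_chanAvg (hX : Measurable X) (hC : ∀ᵐ ω ∂μ, ∀ k, |X ω k| ≤ C)
    (s : ι → ℝ) (k : ι) :
    Integrable (fun p : Ω × (ι → ℝ) => X p.1 k * chanAvg μ X (fun ω => X ω k) s (s * X p.1 + p.2))
      (μ.prod (gaussianPi ι)) := by
  have hXk : Measurable fun ω => X ω k := (measurable_pi_apply k).comp hX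
  have hA1 : ∀ᵐ ω ∂μ, |X ω k| ≤ C := hC.mono fun ω h => h k
  exact (integrable_chanAvg_obs hX hC hXk hA1 _).bdd_mul (c := C)
    (hXk.comp measurable_fst).aestronglyMeasurable (Measure.quasiMeasurePreserving_fst.ae hA1)

lemma integrable_noise_mul_chanAvg (hX : Measurable X) (hC : ∀ᵐ ω ∂μ, ∀ k, |X ω k| ≤ C)
    {φ : Ω → ℝ} (hφ : Measurable φ) {A : ℝ} (hA : ∀ᵐ ω ∂μ, |φ ω| ≤ A) (s : ι → ℝ) (k : ι) :
    Integrable (fun p : Ω × (ι → ℝ) => p.2 k * chanAvg μ X φ s (s * X p.1 + p.2))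
      (μ.prod (gaussianPi ι)) := by
  refine Integrable.mono' (((integrable_abs_eval_gaussianPi k).mul_const A).comp_snd μ) ?_
    (.of_forall fun p => ?_)
  · have := (integrable_chanAvg_obs hX hC hφ hA s).aestronglyMeasurable
    fun_prop
  · rw [norm_mul]
    exact mul_le_mul_of_nonneg_left (abs_chanAvg_le hX hC hA s _) (norm_nonneg _)

lemma integral_noise_mul_chanAvg (hX : Measurable X) (hC : ∀ᵐ ω ∂μ, ∀ k, |X ω k| ≤ C)
    (s : ι → ℝ) (k : ι) :
    ∫ p, p.2 k * chanAvg μ X (fun ω => X ω k) s (s * X p.1 + p.2) ∂(μ.prod (gaussianPi ι)) =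
      s k * (∫ p, chanAvg μ X (fun ω => X ω k ^ 2) s (s * X p.1 + p.2) ∂(μ.prod (gaussianPi ι))
        - ∫ p, chanAvg μ X (fun ω => X ω k) s (s * X p.1 + p.2) ^ 2
          ∂(μ.prod (gaussianPi ι))) := by
  classical
  have hXk : Measurable fun ω => X ω k := (measurable_pi_apply k).comp hX
  have hA1 : ∀ᵐ ω ∂μ, |X ω k| ≤ C := hC.mono fun ω h => h k
  have hA2 : ∀ᵐ ω ∂μ, |X ω k ^ 2| ≤ C ^ 2 := hA1.mono fun ω h => by
    rw [abs_pow]; exact pow_le_pow_left₀ (abs_nonneg _) h 2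
  have c1 := continuous_chanAvg_obs hX hC hXk hA1 s
  have c2 := continuous_chanAvg_obs hX hC (hXk.pow_const 2) hA2 s
  have b1 := abs_chanAvg_le hX hC hA1 s
  have b2 := abs_chanAvg_le hX hC hA2 s
  have i2 := integrable_chanAvg_obs hX hC (hXk.pow_const 2) hA2 s
  have i3 : Integrable (fun p : Ω × (ι → ℝ) =>
      chanAvg μ X (fun ω => X ω k) s (s * X p.1 + p.2) ^ 2) (μ.prod (gaussianPi ι)) :=
    Integrable.of_bound ((c1.pow 2).measurable.comp (by fun_prop)).aestronglyMeasurable (C ^ 2)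
      (.of_forall fun p => by
        rw [norm_pow]; exact pow_le_pow_left₀ (norm_nonneg _) (b1 _) 2)
  have i4 : Integrable (fun p : Ω × (ι → ℝ) =>
      s k * (chanAvg μ X (fun ω => X ω k ^ 2) s (s * X p.1 + p.2)
        - chanAvg μ X (fun ω => X ω k) s (s * X p.1 + p.2) ^ 2)) (μ.prod (gaussianPi ι)) :=
    (i2.sub i3).const_mul _
  rw [← integral_sub i2 i3, ← integral_const_mul,
    integral_prod _ (integrable_noise_mul_chanAvg hX hC hXk hA1 s k),
    integral_prod _ i4]
  refine integral_congr_ae (.of_forall fun ω => ?_)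
  refine integral_eval_mul_gaussianPi (A := C) (A' := |s k| * (C ^ 2 + C ^ 2)) k
    (m := fun z => chanAvg μ X (fun ω => X ω k) s (s * X ω + z))
    (m' := fun z => s k * (chanAvg μ X (fun ω => X ω k ^ 2) s (s * X ω + z)
      - chanAvg μ X (fun ω => X ω k) s (s * X ω + z) ^ 2))
    (c1.comp (by fun_prop)).measurable (by
      have := c1.comp (by fun_prop : Continuous fun z => s * X ω + z)
      have := c2.comp (by fun_prop : Continuous fun z => s * X ω + z)
      simp only [Function.comp_def] at *
      exact Continuous.measurable (by fun_prop))
    (fun z => b1 _) (fun z => ?_) (fun z τ => ?_)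
  · rw [abs_mul]
    gcongr
    refine (abs_sub _ _).trans (add_le_add (b2 _) ?_)
    rw [abs_pow]
    exact pow_le_pow_left₀ (abs_nonneg _) (b1 _) 2
  · have h := hasDerivAt_chanAvg hX hC hXk hA1 s 0 (s * X ω + z) (Pi.single k 1) τ
    have hdir : ∀ y x : ι → ℝ, chanExpDir s 0 y (Pi.single k 1) x = s k * x k := fun y x => by
      unfold chanExpDir
      rw [Finset.sum_eq_single k] <;> simp +contextual
    simp only [smul_zero, add_zero, hdir, add_assoc] at h
    refine h.congr_deriv ?_
    have e1 : ∀ y, chanAvg μ X (fun ω => s k * X ω k) s y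
        = s k * chanAvg μ X (fun ω => X ω k) s y := fun y => by
      simp only [chanAvg, chanNum, mul_assoc, integral_const_mul, mul_div_assoc]
    have e2 : ∀ y, chanAvg μ X (fun ω => X ω k * (s k * X ω k)) s y
        = s k * chanAvg μ X (fun ω => X ω k ^ 2) s y := fun y => by
      have : (fun ω => X ω k * (s k * X ω k)) = fun ω => s k * X ω k ^ 2 := by ext; ring
      rw [this]
      simp only [chanAvg, chanNum, mul_assoc, integral_const_mul, mul_div_assoc]
    rw [e1, e2]
    ring

lemma integrable_log_chanZ_obs (hX : Measurable X) (hC : ∀ᵐ ω ∂μ, ∀ k, |X ω k| ≤ C) (s : ι → ℝ) :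
    Integrable (fun p : Ω × (ι → ℝ) => log (chanZ μ X s (s * X p.1 + p.2)))
      (μ.prod (gaussianPi ι)) := by
  have hc : Continuous fun y => log (chanZ μ X s y) :=
    (continuous_log_chanZ hX hC).comp (by fun_prop : Continuous fun y => (s, y))
  refine Integrable.mono' (g := fun p => ∑ k, (|s k| * |C| * (|s k| * C + |p.2 k|)
    + s k ^ 2 * C ^ 2 / 2)) ?_ (hc.measurable.comp (by fun_prop)).aestronglyMeasurable ?_
  · refine integrable_finsetSum _ fun k _ => ?_
    exact (((integrable_const _).add ((integrable_abs_eval_gaussianPi k).comp_snd μ)).const_mul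
      _).add (integrable_const _)
  · filter_upwards [Measure.quasiMeasurePreserving_fst.ae hC] with p hp
    refine (abs_log_chanZ_le hX hC s _).trans (Finset.sum_le_sum fun k _ => ?_)
    gcongr
    · exact le_abs_self C
    · refine (abs_add_le _ _).trans ?_
      rw [Pi.mul_apply, abs_mul]
      gcongr
      exact hp k

/-- Derivative of the average free entropy of a Gaussian channel along a line in the space of
square roots of the signal-to-noise ratios. -/
lemma hasDerivAt_chanF (hX : Measurable X) (hC : ∀ᵐ ω ∂μ, ∀ k, |X ω k| ≤ C) (hC0 : 0 ≤ C)
    (s d : ι → ℝ) (θ : ℝ) :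
    HasDerivAt (fun θ : ℝ => chanF μ X (s + θ • d))
      (∑ k, d k * (s + θ • d) k * chanG μ X (s + θ • d) k) θ := by
  have hline : ∀ (t : ℝ) (p : Ω × (ι → ℝ)),
      (s + t • d) * X p.1 + p.2 = (s * X p.1 + p.2) + t • (d * X p.1) := fun t p => by
    ext k; simp; ring
  have hXk : ∀ k, Measurable fun ω => X ω k := fun k => (measurable_pi_apply k).comp hX
  have hA1 : ∀ k, ∀ᵐ ω ∂μ, |X ω k| ≤ C := fun k => hC.mono fun ω h => h k
  have hA2 : ∀ k, ∀ᵐ ω ∂μ, |X ω k ^ 2| ≤ C ^ 2 := fun k => (hA1 k).mono fun ω h => by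
    rw [abs_pow]; exact pow_le_pow_left₀ (abs_nonneg _) h 2
  have i1 := integrable_signal_mul_chanAvg hX hC (s + θ • d)
  have i2 : ∀ k, Integrable (fun p : Ω × (ι → ℝ) => chanAvg μ X (fun ω => X ω k ^ 2)
      (s + θ • d) ((s + θ • d) * X p.1 + p.2)) (μ.prod (gaussianPi ι)) := fun k =>
    integrable_chanAvg_obs hX hC ((hXk k).pow_const 2) (hA2 k) _
  have i3 := fun k => integrable_noise_mul_chanAvg hX hC (hXk k) (hA1 k) (s + θ • d) k
  have hdir : ∀ p : Ω × (ι → ℝ), chanAvg μ X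
      (fun ω => chanExpDir (s + θ • d) d ((s + θ • d) * X p.1 + p.2) (d * X p.1) (X ω))
        (s + θ • d) ((s + θ • d) * X p.1 + p.2) =
      ∑ k, (2 * (d k * (s + θ • d) k) * (X p.1 k * chanAvg μ X (fun ω => X ω k)
          (s + θ • d) ((s + θ • d) * X p.1 + p.2))
        + d k * (p.2 k * chanAvg μ X (fun ω => X ω k)
          (s + θ • d) ((s + θ • d) * X p.1 + p.2))
        - d k * (s + θ • d) k * chanAvg μ X (fun ω => X ω k ^ 2)
          (s + θ • d) ((s + θ • d) * X p.1 + p.2)) := fun p => by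
    rw [chanAvg_chanExpDir hX hC]
    refine Finset.sum_congr rfl fun k _ => ?_
    simp only [Pi.add_apply, Pi.mul_apply]
    ring
  have i4 : ∀ k ∈ Finset.univ, Integrable (fun p : Ω × (ι → ℝ) =>
      2 * (d k * (s + θ • d) k) * (X p.1 k * chanAvg μ X (fun ω => X ω k)
          (s + θ • d) ((s + θ • d) * X p.1 + p.2))
        + d k * (p.2 k * chanAvg μ X (fun ω => X ω k)
          (s + θ • d) ((s + θ • d) * X p.1 + p.2))
        - d k * (s + θ • d) k * chanAvg μ X (fun ω => X ω k ^ 2)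
          (s + θ • d) ((s + θ • d) * X p.1 + p.2)) (μ.prod (gaussianPi ι)) := fun k _ =>
    (((i1 k).const_mul _).add ((i3 k).const_mul _)).sub ((i2 k).const_mul _)
  have hS : ∀ k, ∀ t ∈ Metric.ball θ 1, |(s + t • d) k| ≤ |s k| + (|θ| + 1) * |d k| := by
    intro k t ht
    rw [Metric.mem_ball, Real.dist_eq] at ht
    have : |t| ≤ |θ| + 1 := by
      have := abs_sub_abs_le_abs_sub t θ
      linarith
    refine (abs_add_le _ _).trans ?_
    rw [Pi.smul_apply, smul_eq_mul, abs_mul]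
    gcongr
  set S : ι → ℝ := fun k => |s k| + (|θ| + 1) * |d k|
  have hS0 : ∀ k, 0 ≤ S k := fun k => by positivity
  have key := (hasDerivAt_integral_of_dominated_loc_of_deriv_le (μ := μ.prod (gaussianPi ι))
    (x₀ := θ) (Metric.ball_mem_nhds θ one_pos)
    (F := fun t p => log (chanZ μ X (s + t • d) ((s + t • d) * X p.1 + p.2)))
    (F' := fun t p => chanAvg μ X
      (fun ω => chanExpDir (s + t • d) d ((s + t • d) * X p.1 + p.2) (d * X p.1) (X ω))
        (s + t • d) ((s + t • d) * X p.1 + p.2))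
    (bound := fun p => ∑ k, (|d k| * C * (S k * C + |p.2 k|) + S k * C * (|d k| * C)
      + S k * |d k| * C ^ 2))
    (.of_forall fun t => (integrable_log_chanZ_obs hX hC _).aestronglyMeasurable)
    (integrable_log_chanZ_obs hX hC _) ?_ ?_ ?_ (.of_forall fun p t _ => ?_)).2
  · refine key.congr_deriv ?_
    simp_rw [hdir]
    rw [integral_finsetSum _ i4]
    refine Finset.sum_congr rfl fun k _ => ?_
    have i5 : Integrable (fun p : Ω × (ι → ℝ) =>
        2 * (d k * (s + θ • d) k) * (X p.1 k * chanAvg μ X (fun ω => X ω k)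
            (s + θ • d) ((s + θ • d) * X p.1 + p.2))
          + d k * (p.2 k * chanAvg μ X (fun ω => X ω k)
            (s + θ • d) ((s + θ • d) * X p.1 + p.2))) (μ.prod (gaussianPi ι)) :=
      ((i1 k).const_mul _).add ((i3 k).const_mul _)
    rw [integral_sub i5 ((i2 k).const_mul _),
      integral_add ((i1 k).const_mul _) ((i3 k).const_mul _), integral_const_mul,
      integral_const_mul, integral_const_mul, integral_noise_mul_chanAvg hX hC,
      ← integral_signal_mul_chanAvg hX hC (hXk k) (hA1 k), chanG]
    ring
  · simp_rw [hdir]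
    exact (integrable_finsetSum _ i4).aestronglyMeasurable
  · filter_upwards [Measure.quasiMeasurePreserving_fst.ae hC] with p hp t ht
    refine (abs_chanAvg_le hX hC (hC.mono fun ω hω => abs_chanExpDir_le hω _ _ _ _) _ _).trans
      (Finset.sum_le_sum fun k _ => ?_)
    have h1 : |((s + t • d) * X p.1 + p.2) k| ≤ S k * C + |p.2 k| := by
      refine (abs_add_le _ _).trans ?_
      rw [Pi.mul_apply, abs_mul]
      have := hS k t ht
      have := hp k
      have := hS0 k
      gcongr
    have h2 : |(d * X p.1) k| ≤ |d k| * C := by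
      rw [Pi.mul_apply, abs_mul]
      gcongr
      exact hp k
    have h3 := hS k t ht
    have := hS0 k
    gcongr
  · refine integrable_finsetSum _ fun k _ => ?_
    exact ((((integrable_const _).add ((integrable_abs_eval_gaussianPi k).comp_snd μ)).const_mul
      _).add (integrable_const _)).add (integrable_const _)
  · have h := hasDerivAt_log_chanZ hX hC s d (s * X p.1 + p.2) (d * X p.1) t
    simp only [← hline] at h
    exact h

lemma continuous_chanG (hX : Measurable X) (hC : ∀ᵐ ω ∂μ, ∀ k, |X ω k| ≤ C) (k : ι) :
    Continuous fun s => chanG μ X s k := by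
  have hXk : Measurable fun ω => X ω k := (measurable_pi_apply k).comp hX
  have hA1 : ∀ᵐ ω ∂μ, |X ω k| ≤ C := hC.mono fun ω h => h k
  refine continuous_of_dominated (bound := fun _ => C * C) (fun s => ?_) (fun s => ?_)
    (integrable_const _) (.of_forall fun p => ?_)
  · have := (integrable_chanAvg_obs hX hC hXk hA1 s).aestronglyMeasurable
    exact (hXk.comp measurable_fst).aestronglyMeasurable.mul this
  · filter_upwards [Measure.quasiMeasurePreserving_fst.ae hA1] with p hp
    rw [norm_mul]
    exact mul_le_mul hp (abs_chanAvg_le hX hC hA1 _ _) (norm_nonneg _) ((abs_nonneg _).trans hp)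
  · exact continuous_const.mul ((continuous_chanAvg hX hC hXk hA1).comp
      (by fun_prop : Continuous fun s : ι → ℝ => (s, s * X p.1 + p.2)))

/-- First-order expansion of the free entropy in the signal-to-noise ratios `s k ^ 2`, valid up
to the boundary of the nonnegative orthant. -/
lemma eventually_abs_chanF_sub_le (hX : Measurable X) (hC : ∀ᵐ ω ∂μ, ∀ k, |X ω k| ≤ C)
    (hC0 : 0 ≤ C) {s : ι → ℝ} (hs : ∀ k, 0 ≤ s k) {ε : ℝ} (hε : 0 < ε) :
    ∀ᶠ s' in nhds s, (∀ k, 0 ≤ s' k) →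
      |(chanF μ X s' - ∑ k, 1 / 2 * chanG μ X s k * s' k ^ 2)
        - (chanF μ X s - ∑ k, 1 / 2 * chanG μ X s k * s k ^ 2)|
      ≤ ε * ∑ k, |s' k ^ 2 - s k ^ 2| := by
  have hG : ∀ᶠ s' in nhds s, ∀ k, |chanG μ X s' k - chanG μ X s k| < ε := by
    rw [eventually_all]
    intro k
    exact (continuous_chanG hX hC k).continuousAt.eventually (Metric.ball_mem_nhds _ hε)
  obtain ⟨δ, hδ, hball⟩ := Metric.eventually_nhds_iff_ball.1 hG
  filter_upwards [Metric.ball_mem_nhds s hδ] with s' hs' hs'0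
  set d : ι → ℝ := s' - s with hd
  have hderiv : ∀ θ : ℝ, HasDerivAt (fun θ : ℝ => chanF μ X (s + θ • d)
      - ∑ k, 1 / 2 * chanG μ X s k * (s + θ • d) k ^ 2)
      (∑ k, d k * (s + θ • d) k * (chanG μ X (s + θ • d) k - chanG μ X s k)) θ := fun θ => by
    have h2 : HasDerivAt (fun θ : ℝ => ∑ k, 1 / 2 * chanG μ X s k * (s + θ • d) k ^ 2)
        (∑ k, d k * (s + θ • d) k * chanG μ X s k) θ := by
      refine HasDerivAt.fun_sum fun k _ => ?_
      have hsk : HasDerivAt (fun θ : ℝ => (s + θ • d) k) (d k) θ := by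
        simpa using ((hasDerivAt_id θ).mul_const (d k)).const_add (s k)
      refine ((hsk.pow 2).const_mul (1 / 2 * chanG μ X s k)).congr_deriv ?_
      simp only [Nat.cast_ofNat]
      ring
    refine ((hasDerivAt_chanF hX hC hC0 s d θ).sub h2).congr_deriv ?_
    rw [← Finset.sum_sub_distrib]
    exact Finset.sum_congr rfl fun k _ => by ring
  have h := norm_image_sub_le_of_norm_deriv_le_segment_01'
    (fun θ _ => (hderiv θ).hasDerivWithinAt) (C := ε * ∑ k, |s' k ^ 2 - s k ^ 2|) (fun θ hθ => ?_)
  · simpa [hd] using h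
  · rw [Finset.mul_sum]
    refine (norm_sum_le _ _).trans (Finset.sum_le_sum fun k _ => ?_)
    have hmem : s + θ • d ∈ Metric.ball s δ := by
      rw [Metric.mem_ball, dist_eq_norm, add_sub_cancel_left, norm_smul, Real.norm_eq_abs,
        abs_of_nonneg hθ.1]
      rw [Metric.mem_ball, dist_eq_norm] at hs'
      exact (mul_le_of_le_one_left (norm_nonneg _) hθ.2.le).trans_lt hs'
    have h1 : (s + θ • d) k = (1 - θ) * s k + θ * s' k := by simp [hd]; ring
    have h2 : 0 ≤ (s + θ • d) k := by
      rw [h1]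
      have := hs k
      have := hs'0 k
      have := hθ.1
      have := sub_nonneg.2 hθ.2.le
      positivity
    have h3 : (s + θ • d) k ≤ s' k + s k := by
      rw [h1]
      nlinarith [hs k, hs'0 k, hθ.1, hθ.2, mul_nonneg hθ.1 (hs k),
        mul_nonneg (sub_nonneg.2 hθ.2.le) (hs'0 k)]
    have h4 : s' k ^ 2 - s k ^ 2 = (s' k - s k) * (s' k + s k) := by ring
    rw [norm_mul, norm_mul, Real.norm_eq_abs, Real.norm_eq_abs, Real.norm_eq_abs,
      abs_of_nonneg h2, h4, abs_mul, abs_of_nonneg (add_nonneg (hs'0 k) (hs k)), mul_comm ε]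
    have := (hball _ hmem k).le
    have h5 : 0 ≤ s' k + s k := add_nonneg (hs'0 k) (hs k)
    rw [hd, Pi.sub_apply]
    gcongr

/-- The I-MMSE formula along a differentiable path of nonnegative signal-to-noise ratios. -/
theorem hasDerivWithinAt_chanF_sqrt (hX : Measurable X) (hC : ∀ᵐ ω ∂μ, ∀ k, |X ω k| ≤ C)
    (hC0 : 0 ≤ C) {I : Set ℝ} {lam : ℝ → ι → ℝ} {lam' : ι → ℝ} {t : ℝ} (ht : t ∈ I)
    (hpos : ∀ r ∈ I, ∀ k, 0 ≤ lam r k)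
    (hlam : ∀ k, HasDerivWithinAt (fun r => lam r k) (lam' k) I t) :
    HasDerivWithinAt (fun r => chanF μ X (fun k => √(lam r k)))
      (∑ k, 1 / 2 * lam' k * chanG μ X (fun k => √(lam t k)) k) I t := by
  set s : ι → ℝ := fun k => √(lam t k) with hs
  have hcont : Tendsto (fun r => fun k => √(lam r k)) (nhdsWithin t I) (nhds s) :=
    tendsto_pi_nhds.2 fun k => (hlam k).continuousWithinAt.sqrt
  have hsum : HasDerivWithinAt (fun r => ∑ k, 1 / 2 * chanG μ X s k * lam r k)
      (∑ k, 1 / 2 * lam' k * chanG μ X s k) I t := by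
    refine (HasDerivWithinAt.fun_sum fun k _ =>
      (hlam k).const_mul (1 / 2 * chanG μ X s k)).congr_deriv ?_
    exact Finset.sum_congr rfl fun k _ => by ring
  have hO : (fun r => ∑ k, |lam r k - lam t k|) =O[nhdsWithin t I] fun r => r - t :=
    Asymptotics.IsBigO.fun_sum fun k _ => (hlam k).differentiableWithinAt.isBigO_sub.abs_left
  have hrem : HasDerivWithinAt (fun r => chanF μ X (fun k => √(lam r k))
      - ∑ k, 1 / 2 * chanG μ X s k * lam r k) 0 I t := by
    rw [hasDerivWithinAt_iff_isLittleO]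
    simp only [smul_zero, sub_zero]
    refine Asymptotics.IsLittleO.trans_isBigO ?_ hO
    rw [Asymptotics.isLittleO_iff]
    intro ε hε
    filter_upwards [hcont.eventually (eventually_abs_chanF_sub_le hX hC hC0
      (fun k => Real.sqrt_nonneg _) hε), self_mem_nhdsWithin] with r hr hrI
    have := hr fun k => Real.sqrt_nonneg _
    simp only [Real.sq_sqrt (hpos r hrI _), Real.sq_sqrt (hpos t ht _)] at this
    rw [Real.norm_eq_abs, Real.norm_eq_abs,
      abs_of_nonneg (Finset.sum_nonneg fun k _ => abs_nonneg (lam r k - lam t k))]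
    exact this
  simpa using hrem.fun_add hsum

end FreeEntropy

section SumGaussianPi

instance (n : ℕ) : IsProbabilityMeasure (stdGaussian n) := by
  unfold stdGaussian; infer_instance

instance (p q : ℕ) : IsProbabilityMeasure (stdGaussianMat p q) := by
  unfold stdGaussianMat; infer_instance

/-- The standard Gaussian measure on families indexed by `(ι × κ) ⊕ (ι ⊕ κ)`, assembled from its
three blocks. -/
lemma measurePreserving_sumElim_gaussianPi (nu nv : ℕ) :
    MeasurePreserving (fun q : (Fin nu → Fin nv → ℝ) × (Fin nu → ℝ) × (Fin nv → ℝ) =>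
      (Sum.elim (fun ij : Fin nu × Fin nv => q.1 ij.1 ij.2) (Sum.elim q.2.1 q.2.2) :
        (Fin nu × Fin nv) ⊕ (Fin nu ⊕ Fin nv) → ℝ))
      ((stdGaussianMat nu nv).prod ((stdGaussian nu).prod (stdGaussian nv)))
      (gaussianPi ((Fin nu × Fin nv) ⊕ (Fin nu ⊕ Fin nv))) := by
  have h1 : MeasurePreserving (MeasurableEquiv.curry (Fin nu) (Fin nv) ℝ).symm
      (stdGaussianMat nu nv) (gaussianPi (Fin nu × Fin nv)) := by
    refine ⟨MeasurableEquiv.measurable _, ?_⟩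
    have := Measure.infinitePi_map_curry_symm
      (fun (_ : Fin nu) (_ : Fin nv) => ProbabilityTheory.gaussianReal 0 1)
    simp only [Measure.infinitePi_eq_pi] at this
    exact this
  have h2 := measurePreserving_sumPiEquivProdPi_symm (X := fun _ : Fin nu ⊕ Fin nv => ℝ)
    fun _ => ProbabilityTheory.gaussianReal 0 1
  have h3 := measurePreserving_sumPiEquivProdPi_symm
    (X := fun _ : (Fin nu × Fin nv) ⊕ (Fin nu ⊕ Fin nv) => ℝ)
    fun _ => ProbabilityTheory.gaussianReal 0 1
  have h := h3.comp (h1.prod h2)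
  convert! h using 1

end SumGaussianPi

section PosteriorSum

variable {Ω ι : Type*} [MeasurableSpace Ω] [Fintype ι]
variable {μ : Measure Ω} [IsProbabilityMeasure μ] {X : Ω → ι → ℝ} {C : ℝ}

lemma chanAvg_affine (hX : Measurable X) (hC : ∀ᵐ ω ∂μ, ∀ k, |X ω k| ≤ C) (b x : ι → ℝ) (c : ℝ)
    (s y : ι → ℝ) :
    chanAvg μ X (fun ω => ∑ k, b k * (x k * X ω k) + c) s y =
      ∑ k, b k * (x k * chanAvg μ X (fun ω => X ω k) s y) + c := by
  have hXk : ∀ k, Measurable fun ω => X ω k := fun k => (measurable_pi_apply k).comp hX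
  have h1 : ∀ k ∈ Finset.univ, Integrable (fun ω =>
      b k * (x k * (X ω k * exp (chanExp s (X ω) y)))) μ := fun k _ =>
    ((integrable_chanNum hX hC (hXk k) (hC.mono fun ω h => h k) s y).const_mul _).const_mul _
  have h2 : Integrable (fun ω => c * (1 * exp (chanExp s (X ω) y))) μ :=
    (integrable_chanNum (φ := fun _ => 1) (A := 1) hX hC (by fun_prop) (by simp) s y).const_mul _
  have h3 : chanNum μ X (fun ω => ∑ k, b k * (x k * X ω k) + c) s y =
      ∑ k, b k * (x k * chanNum μ X (fun ω => X ω k) s y) + c * chanZ μ X s y := by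
    rw [← chanNum_one]
    simp only [chanNum, ← integral_const_mul]
    rw [← integral_finsetSum _ h1, ← integral_add (integrable_finsetSum _ h1) h2]
    refine integral_congr_ae (.of_forall fun ω => ?_)
    simp only [add_mul, Finset.sum_mul]
    congr 1
    · exact Finset.sum_congr rfl fun k _ => by ring
    · ring
  have hZ := (chanZ_pos hX hC s y).ne'
  rw [chanAvg, h3, add_div, mul_div_cancel_right₀ _ hZ, Finset.sum_div]
  congr 1
  exact Finset.sum_congr rfl fun k _ => by simp only [chanAvg]; ring

lemma integrable_chanAvg_affine (hX : Measurable X) (hC : ∀ᵐ ω ∂μ, ∀ k, |X ω k| ≤ C) (b : ι → ℝ)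
    (c : ℝ) (s : ι → ℝ) :
    Integrable (fun p : Ω × (ι → ℝ) =>
      chanAvg μ X (fun ω => ∑ k, b k * (X p.1 k * X ω k) + c) s (s * X p.1 + p.2))
      (μ.prod (gaussianPi ι)) := by
  simp_rw [chanAvg_affine hX hC]
  exact (integrable_finsetSum _ fun k _ =>
    (integrable_signal_mul_chanAvg hX hC s k).const_mul (b k)).add (integrable_const c)

lemma integral_chanAvg_affine (hX : Measurable X) (hC : ∀ᵐ ω ∂μ, ∀ k, |X ω k| ≤ C) (b : ι → ℝ)
    (c : ℝ) (s : ι → ℝ) :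
    ∫ p, chanAvg μ X (fun ω => ∑ k, b k * (X p.1 k * X ω k) + c) s (s * X p.1 + p.2)
      ∂(μ.prod (gaussianPi ι)) = ∑ k, b k * chanG μ X s k + c := by
  simp_rw [chanAvg_affine hX hC]
  have h : ∀ k ∈ Finset.univ, Integrable (fun p : Ω × (ι → ℝ) =>
      b k * (X p.1 k * chanAvg μ X (fun ω => X ω k) s (s * X p.1 + p.2)))
      (μ.prod (gaussianPi ι)) :=
    fun k _ => (integrable_signal_mul_chanAvg hX hC s k).const_mul (b k)
  rw [integral_add (integrable_finsetSum _ h) (integrable_const c), integral_finsetSum _ h]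
  simp [integral_const_mul, chanG]

lemma abs_sum_mul_chanG_le (hX : Measurable X) (hC : ∀ᵐ ω ∂μ, ∀ k, |X ω k| ≤ C) (b : ι → ℝ)
    {A : ℝ} (hA : ∀ᵐ ω ∂μ, ∀ᵐ ω' ∂μ, |∑ k, b k * (X ω k * X ω' k)| ≤ A) (s : ι → ℝ) :
    |∑ k, b k * chanG μ X s k| ≤ A := by
  have h := integral_chanAvg_affine hX hC b 0 s
  rw [add_zero] at h
  rw [← h]
  have := norm_integral_le_of_norm_le_const (μ := μ.prod (gaussianPi ι)) (C := A)
    (f := fun p => chanAvg μ X (fun ω => ∑ k, b k * (X p.1 k * X ω k) + 0) s (s * X p.1 + p.2)) (by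
      filter_upwards [Measure.quasiMeasurePreserving_fst.ae hA] with p hp
      exact abs_chanAvg_le hX hC (by simpa using hp) s _)
  simpa using this

end PosteriorSum

section PairChannel

variable {n nu nv : ℕ} {au av t Ru Rv : ℝ}

/-- The entries of `u vᵀ`, `u` and `v`, which the interpolating channels transmit. -/
def pairSignal (p : (Fin nu → ℝ) × (Fin nv → ℝ)) : (Fin nu × Fin nv) ⊕ (Fin nu ⊕ Fin nv) → ℝ :=
  Sum.elim (fun ij => p.1 ij.1 * p.2 ij.2) (Sum.elim p.1 p.2)

/-- The signal-to-noise ratios of the interpolating channels. -/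
def pairSnr (n nu nv : ℕ) (au av t Ru Rv : ℝ) : (Fin nu × Fin nv) ⊕ (Fin nu ⊕ Fin nv) → ℝ :=
  Sum.elim (fun _ => (1 - t) / n) (Sum.elim (fun _ => av * Rv) (fun _ => au * Ru))

/-- The square roots of the signal-to-noise ratios of the interpolating channels. -/
def pairScale (n nu nv : ℕ) (au av t Ru Rv : ℝ) : (Fin nu × Fin nv) ⊕ (Fin nu ⊕ Fin nv) → ℝ :=
  fun k => √(pairSnr n nu nv au av t Ru Rv k)

lemma measurable_pairSignal : Measurable (pairSignal (nu := nu) (nv := nv)) := by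
  refine measurable_pi_iff.2 ?_
  rintro (⟨i, j⟩ | i | j) <;> simp only [pairSignal, Sum.elim_inl, Sum.elim_inr] <;> fun_prop

lemma neg_interpH (hk : ∀ k, 0 ≤ pairSnr n nu nv au av t Ru Rv k) (U : Fin nu → ℝ)
    (V : Fin nv → ℝ) (Z : Fin nu → Fin nv → ℝ) (Zt : Fin nu → ℝ) (Zb : Fin nv → ℝ)
    (u : Fin nu → ℝ) (v : Fin nv → ℝ) :
    -interpH n nu nv au av t Ru Rv U V Z Zt Zb u v =
      chanExp (pairScale n nu nv au av t Ru Rv) (pairSignal (u, v))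
        (pairScale n nu nv au av t Ru Rv * pairSignal (U, V)
          + Sum.elim (fun ij : Fin nu × Fin nv => Z ij.1 ij.2) (Sum.elim Zt Zb)) := by
  simp only [interpH, chanExp, Fintype.sum_sum_type, Fintype.sum_prod_type, pairSignal,
    pairScale, Pi.add_apply, Pi.mul_apply, Real.sq_sqrt (hk _)]
  simp only [pairSnr, Sum.elim_inl, Sum.elim_inr, neg_add, ← Finset.sum_neg_distrib, add_assoc]
  refine congrArg₂ _ (Finset.sum_congr rfl fun i _ => Finset.sum_congr rfl fun j _ => ?_)
    (congrArg₂ _ (Finset.sum_congr rfl fun i _ => ?_) (Finset.sum_congr rfl fun j _ => ?_)) <;>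
  ring

lemma Efull_eq_integral {Pu : Measure (Fin nu → ℝ)} {Pv : Measure (Fin nv → ℝ)}
    [IsProbabilityMeasure Pu] [IsProbabilityMeasure Pv]
    {g : ((Fin nu → ℝ) × (Fin nv → ℝ)) × ((Fin nu × Fin nv) ⊕ (Fin nu ⊕ Fin nv) → ℝ) → ℝ}
    (hg : Integrable g ((Pu.prod Pv).prod (gaussianPi _))) :
    Efull nu nv Pu Pv (fun U V Z Zt Zb =>
      g ((U, V), Sum.elim (fun ij => Z ij.1 ij.2) (Sum.elim Zt Zb))) =
      ∫ p, g p ∂((Pu.prod Pv).prod (gaussianPi _)) := by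
  have hT := (MeasurePreserving.id (Pu.prod Pv)).prod (measurePreserving_sumElim_gaussianPi nu nv)
  have hg' := hT.integrable_comp_of_integrable hg
  have hI := integral_map hT.measurable.aemeasurable (f := g)
    (hT.map_eq.symm ▸ hg.aestronglyMeasurable)
  rw [hT.map_eq] at hI
  rw [hI]
  change _ = ∫ z, (g ∘ _) z ∂_
  rw [ integral_prod _ hg', integral_prod _ hg'.integral_prod_left, Efull]
  refine integral_congr_ae ((Measure.ae_ae_of_ae_prod hg'.prod_right_ae).mono fun U hU =>
    integral_congr_ae (hU.mono fun V hUV => ?_))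
  refine Eq.trans ?_ (integral_prod _ hUV).symm
  refine integral_congr_ae (hUV.prod_right_ae.mono fun Z hZ => ?_)
  exact (integral_prod _ hZ).symm

variable {Pu : Measure (Fin nu → ℝ)} {Pv : Measure (Fin nv → ℝ)} [IsProbabilityMeasure Pu]
  [IsProbabilityMeasure Pv] {C : ℝ}

lemma integral_integral_mul_exp_neg_interpH (hk : ∀ k, 0 ≤ pairSnr n nu nv au av t Ru Rv k)
    (hC : ∀ᵐ p ∂(Pu.prod Pv), ∀ k, |pairSignal p k| ≤ C)
    {φ : (Fin nu → ℝ) × (Fin nv → ℝ) → ℝ} (hφ : Measurable φ) {A : ℝ}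
    (hA : ∀ᵐ p ∂(Pu.prod Pv), |φ p| ≤ A) (U : Fin nu → ℝ)
    (V : Fin nv → ℝ) (Z : Fin nu → Fin nv → ℝ) (Zt : Fin nu → ℝ) (Zb : Fin nv → ℝ) :
    ∫ u, (∫ v, φ (u, v) * exp (-(interpH n nu nv au av t Ru Rv U V Z Zt Zb u v)) ∂Pv) ∂Pu =
      chanNum (Pu.prod Pv) pairSignal φ (pairScale n nu nv au av t Ru Rv)
        (pairScale n nu nv au av t Ru Rv * pairSignal (U, V)
          + Sum.elim (fun ij : Fin nu × Fin nv => Z ij.1 ij.2) (Sum.elim Zt Zb)) := by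
  rw [chanNum, integral_prod _ (integrable_chanNum measurable_pairSignal hC hφ hA _ _)]
  simp_rw [neg_interpH hk]

lemma partFun_eq_chanZ (hk : ∀ k, 0 ≤ pairSnr n nu nv au av t Ru Rv k)
    (hC : ∀ᵐ p ∂(Pu.prod Pv), ∀ k, |pairSignal p k| ≤ C) (U : Fin nu → ℝ)
    (V : Fin nv → ℝ) (Z : Fin nu → Fin nv → ℝ) (Zt : Fin nu → ℝ) (Zb : Fin nv → ℝ) :
    partFun n nu nv au av t Ru Rv Pu Pv U V Z Zt Zb =
      chanZ (Pu.prod Pv) pairSignal (pairScale n nu nv au av t Ru Rv)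
        (pairScale n nu nv au av t Ru Rv * pairSignal (U, V)
          + Sum.elim (fun ij : Fin nu × Fin nv => Z ij.1 ij.2) (Sum.elim Zt Zb)) := by
  have h := integral_integral_mul_exp_neg_interpH (φ := fun _ => 1) (A := 1) hk hC (by fun_prop)
    (by simp) U V Z Zt Zb
  simp only [one_mul, chanNum_one] at h
  exact h

lemma interpFreeEntropy_eq_chanF (hk : ∀ k, 0 ≤ pairSnr n nu nv au av t Ru Rv k)
    (hC : ∀ᵐ p ∂(Pu.prod Pv), ∀ k, |pairSignal p k| ≤ C) :
    interpFreeEntropy n nu nv au av t Ru Rv Pu Pv =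
      1 / (n : ℝ) * chanF (Pu.prod Pv) pairSignal (pairScale n nu nv au av t Ru Rv) := by
  simp_rw [interpFreeEntropy, partFun_eq_chanZ hk hC]
  rw [Efull_eq_integral (integrable_log_chanZ_obs measurable_pairSignal hC _), chanF]

/-- The expectation of a posterior mean which is affine in the products of the entries of the
signal and of a sample from the posterior. -/
lemma Efull_gibbs_affine (hk : ∀ k, 0 ≤ pairSnr n nu nv au av t Ru Rv k)
    (hC : ∀ᵐ p ∂(Pu.prod Pv), ∀ k, |pairSignal p k| ≤ C)
    (b : (Fin nu × Fin nv) ⊕ (Fin nu ⊕ Fin nv) → ℝ) (c : ℝ)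
    {f : (Fin nu → ℝ) → (Fin nv → ℝ) → (Fin nu → ℝ) → (Fin nv → ℝ) → ℝ}
    (hf : ∀ U V u v, f U V u v = ∑ k, b k * (pairSignal (U, V) k * pairSignal (u, v) k) + c) :
    Efull nu nv Pu Pv (fun U V Z Zt Zb =>
      gibbs n nu nv au av t Ru Rv Pu Pv U V Z Zt Zb (f U V)) =
      ∑ k, b k * chanG (Pu.prod Pv) pairSignal (pairScale n nu nv au av t Ru Rv) k + c := by
  have hX := measurable_pairSignal (nu := nu) (nv := nv)
  rw [← integral_chanAvg_affine hX hC, ← Efull_eq_integral (integrable_chanAvg_affine hX hC b c _)]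
  congr 1
  ext U V Z Zt Zb
  rw [gibbs, partFun_eq_chanZ hk hC, chanAvg]
  congr 1
  simp only [hf]
  refine integral_integral_mul_exp_neg_interpH
    (φ := fun p => ∑ k, b k * (pairSignal (U, V) k * pairSignal p k) + c)
    (A := ∑ k, |b k| * (|pairSignal (U, V) k| * C) + |c|) hk hC ?_ ?_ U V Z Zt Zb
  · have := fun k => (measurable_pi_apply k).comp hX
    simp only [Function.comp_def] at this
    fun_prop
  · filter_upwards [hC] with p hp
    refine (abs_add_le _ _).trans (add_le_add ((Finset.abs_sum_le_sum_abs _ _).trans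
      (Finset.sum_le_sum fun k _ => ?_)) le_rfl)
    rw [abs_mul, abs_mul]
    gcongr
    exact hp k

lemma overlapU_eq_sum (U u : Fin nu → ℝ) (V v : Fin nv → ℝ) :
    overlapU nu u U = ∑ k, Sum.elim (fun _ => 0) (Sum.elim (fun _ => 1 / (nu : ℝ)) fun _ => 0) k
      * (pairSignal (U, V) k * pairSignal (u, v) k) := by
  simp [overlapU, pairSignal, Finset.mul_sum, mul_comm (u _)]

lemma overlapV_eq_sum (U u : Fin nu → ℝ) (V v : Fin nv → ℝ) :
    overlapV nv v V = ∑ k, Sum.elim (fun _ => 0) (Sum.elim (fun _ => 0) fun _ => 1 / (nv : ℝ)) k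
      * (pairSignal (U, V) k * pairSignal (u, v) k) := by
  simp [overlapV, pairSignal, Finset.mul_sum, mul_comm (v _)]

lemma overlapU_mul_overlapV_eq_sum (U u : Fin nu → ℝ) (V v : Fin nv → ℝ) :
    overlapU nu u U * overlapV nv v V =
      ∑ k, Sum.elim (fun _ => 1 / (nu : ℝ) * (1 / nv)) (fun _ => 0) k
        * (pairSignal (U, V) k * pairSignal (u, v) k) := by
  simp only [overlapU, overlapV, pairSignal, Fintype.sum_sum_type, Sum.elim_inl, Sum.elim_inr,
    zero_mul, Finset.sum_const_zero, add_zero, Fintype.sum_prod_type]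
  rw [mul_mul_mul_comm, Finset.sum_mul_sum, Finset.mul_sum]
  simp_rw [Finset.mul_sum]
  exact Finset.sum_congr rfl fun i _ => Finset.sum_congr rfl fun j _ => by ring

end PairChannel

section Sphere

lemma abs_apply_le_of_sum_sq_eq {m : ℕ} {x : Fin m → ℝ} {r : ℝ} (hr : 0 ≤ r)
    (hx : ∑ i, x i ^ 2 = r ^ 2) (i : Fin m) : |x i| ≤ r :=
  abs_le_of_sq_le_sq (hx ▸ Finset.single_le_sum (f := fun i => x i ^ 2)
    (fun i _ => sq_nonneg (x i)) (Finset.mem_univ i)) hr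

lemma abs_overlapU_le {m : ℕ} {ρ : ℝ} (hρ : 0 ≤ ρ) {x y : Fin m → ℝ}
    (hx : ∑ i, x i ^ 2 = √(ρ * m) ^ 2) (hy : ∑ i, y i ^ 2 = √(ρ * m) ^ 2) :
    |overlapU m x y| ≤ ρ := by
  rw [Real.sq_sqrt (by positivity)] at hx hy
  have h : |∑ i, x i * y i| ≤ ρ * m := by
    refine (Finset.abs_sum_le_sum_abs _ _).trans ?_
    have : ∑ i, |x i * y i| ≤ ∑ i, (1 / 2 * x i ^ 2 + 1 / 2 * y i ^ 2) :=
      Finset.sum_le_sum fun i _ => by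
        rw [abs_mul]
        nlinarith [sq_nonneg (|x i| - |y i|), sq_abs (x i), sq_abs (y i)]
    rw [Finset.sum_add_distrib, ← Finset.mul_sum, ← Finset.mul_sum, hx, hy] at this
    linarith
  rw [overlapU, abs_mul, abs_of_nonneg (by positivity : 0 ≤ 1 / (m : ℝ))]
  rcases Nat.eq_zero_or_pos m with rfl | hm
  · simpa using hρ
  · have : (0 : ℝ) < m := by exact_mod_cast hm
    rw [one_div_mul_eq_div, div_le_iff₀ this]
    exact h

variable {nu nv : ℕ} {ru rv : ℝ} {Pu : Measure (Fin nu → ℝ)} {Pv : Measure (Fin nv → ℝ)}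

lemma ae_prod_sphere (hPu : IsUniformSphere nu √(ru * nu) Pu)
    (hPv : IsUniformSphere nv √(rv * nv) Pv) :
    ∀ᵐ p ∂(Pu.prod Pv), ∑ i, p.1 i ^ 2 = √(ru * nu) ^ 2 ∧ ∑ j, p.2 j ^ 2 = √(rv * nv) ^ 2 := by
  have := hPu.1
  have := hPv.1
  filter_upwards [Measure.quasiMeasurePreserving_fst.ae hPu.2.1,
    Measure.quasiMeasurePreserving_snd.ae hPv.2.1] with p h1 h2 using ⟨h1, h2⟩

lemma exists_abs_pairSignal_le (hPu : IsUniformSphere nu √(ru * nu) Pu)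
    (hPv : IsUniformSphere nv √(rv * nv) Pv) :
    ∃ C, 0 ≤ C ∧ ∀ᵐ p ∂(Pu.prod Pv), ∀ k, |pairSignal p k| ≤ C := by
  refine ⟨(√(ru * nu) + 1) * (√(rv * nv) + 1), by positivity, ?_⟩
  filter_upwards [ae_prod_sphere hPu hPv] with p hp
  have ha := Real.sqrt_nonneg (ru * nu)
  have hb := Real.sqrt_nonneg (rv * nv)
  have h1 := abs_apply_le_of_sum_sq_eq ha hp.1
  have h2 := abs_apply_le_of_sum_sq_eq hb hp.2
  rintro (⟨i, j⟩ | i | j)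
  · simp only [pairSignal, Sum.elim_inl, abs_mul]
    have := h1 i
    have := h2 j
    gcongr <;> linarith
  · simp only [pairSignal, Sum.elim_inl, Sum.elim_inr]
    nlinarith [h1 i, mul_nonneg ha hb]
  · simp only [pairSignal, Sum.elim_inr]
    nlinarith [h2 j, mul_nonneg ha hb]

end Sphere

section Overlaps

variable {n nu nv : ℕ} {au av t Ru Rv ru rv : ℝ} {Pu : Measure (Fin nu → ℝ)}
  {Pv : Measure (Fin nv → ℝ)}

section Expansion

variable [IsProbabilityMeasure Pu] [IsProbabilityMeasure Pv] {C : ℝ}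

lemma eQuQv_eq_sum (hk : ∀ k, 0 ≤ pairSnr n nu nv au av t Ru Rv k)
    (hC : ∀ᵐ p ∂(Pu.prod Pv), ∀ k, |pairSignal p k| ≤ C) :
    eQuQv n nu nv au av t Ru Rv Pu Pv =
      ∑ k, Sum.elim (fun _ => 1 / (nu : ℝ) * (1 / nv)) (fun _ => 0) k
        * chanG (Pu.prod Pv) pairSignal (pairScale n nu nv au av t Ru Rv) k := by
  refine (Efull_gibbs_affine hk hC _ 0
    (f := fun U V u v => overlapU nu u U * overlapV nv v V) fun U V u v => ?_).trans (add_zero _)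
  rw [add_zero, ← overlapU_mul_overlapV_eq_sum]

lemma eQu_eq_sum (hk : ∀ k, 0 ≤ pairSnr n nu nv au av t Ru Rv k)
    (hC : ∀ᵐ p ∂(Pu.prod Pv), ∀ k, |pairSignal p k| ≤ C) :
    eQu n nu nv au av t Ru Rv Pu Pv =
      ∑ k, Sum.elim (fun _ => 0) (Sum.elim (fun _ => 1 / (nu : ℝ)) fun _ => 0) k
        * chanG (Pu.prod Pv) pairSignal (pairScale n nu nv au av t Ru Rv) k := by
  refine (Efull_gibbs_affine hk hC _ 0
    (f := fun U _ u _ => overlapU nu u U) fun U V u v => ?_).trans (add_zero _)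
  rw [add_zero, ← overlapU_eq_sum]

lemma eQv_eq_sum (hk : ∀ k, 0 ≤ pairSnr n nu nv au av t Ru Rv k)
    (hC : ∀ᵐ p ∂(Pu.prod Pv), ∀ k, |pairSignal p k| ≤ C) :
    eQv n nu nv au av t Ru Rv Pu Pv =
      ∑ k, Sum.elim (fun _ => 0) (Sum.elim (fun _ => 0) fun _ => 1 / (nv : ℝ)) k
        * chanG (Pu.prod Pv) pairSignal (pairScale n nu nv au av t Ru Rv) k := by
  refine (Efull_gibbs_affine hk hC _ 0
    (f := fun _ V _ v => overlapV nv v V) fun U V u v => ?_).trans (add_zero _)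
  rw [add_zero, ← overlapV_eq_sum]

lemma eCross_eq (hk : ∀ k, 0 ≤ pairSnr n nu nv au av t Ru Rv k)
    (hC : ∀ᵐ p ∂(Pu.prod Pv), ∀ k, |pairSignal p k| ≤ C) (a b : ℝ) :
    eCross n nu nv au av t Ru Rv a b Pu Pv =
      eQuQv n nu nv au av t Ru Rv Pu Pv - b * eQu n nu nv au av t Ru Rv Pu Pv
        - a * eQv n nu nv au av t Ru Rv Pu Pv + a * b := by
  rw [eQuQv_eq_sum hk hC, eQu_eq_sum hk hC, eQv_eq_sum hk hC, Finset.mul_sum, Finset.mul_sum,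
    ← Finset.sum_sub_distrib, ← Finset.sum_sub_distrib]
  simp_rw [← mul_assoc, ← sub_mul]
  refine Efull_gibbs_affine hk hC _ (a * b)
    (f := fun U V u v => (overlapU nu u U - a) * (overlapV nv v V - b)) fun U V u v => ?_
  simp_rw [sub_mul, mul_assoc]
  rw [Finset.sum_sub_distrib, Finset.sum_sub_distrib, ← Finset.mul_sum, ← Finset.mul_sum,
    ← overlapU_mul_overlapV_eq_sum, ← overlapU_eq_sum, ← overlapV_eq_sum]
  ring

end Expansion

lemma abs_eQuQv_le (hru : 0 ≤ ru) (hrv : 0 ≤ rv) (hPu : IsUniformSphere nu √(ru * nu) Pu)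
    (hPv : IsUniformSphere nv √(rv * nv) Pv) (hk : ∀ k, 0 ≤ pairSnr n nu nv au av t Ru Rv k) :
    |eQuQv n nu nv au av t Ru Rv Pu Pv| ≤ ru * rv := by
  have := hPu.1
  have := hPv.1
  obtain ⟨C, -, hC⟩ := exists_abs_pairSignal_le hPu hPv
  rw [eQuQv_eq_sum hk hC]
  refine abs_sum_mul_chanG_le measurable_pairSignal hC _ ?_ _
  filter_upwards [ae_prod_sphere hPu hPv] with p hp
  filter_upwards [ae_prod_sphere hPu hPv] with q hq
  rw [← overlapU_mul_overlapV_eq_sum p.1 q.1 p.2 q.2, abs_mul]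
  exact mul_le_mul (abs_overlapU_le hru hq.1 hp.1) (abs_overlapU_le hrv hq.2 hp.2)
    (abs_nonneg _) hru

lemma abs_eQu_le (hru : 0 ≤ ru) (hPu : IsUniformSphere nu √(ru * nu) Pu)
    (hPv : IsUniformSphere nv √(rv * nv) Pv) (hk : ∀ k, 0 ≤ pairSnr n nu nv au av t Ru Rv k) :
    |eQu n nu nv au av t Ru Rv Pu Pv| ≤ ru := by
  have := hPu.1
  have := hPv.1
  obtain ⟨C, -, hC⟩ := exists_abs_pairSignal_le hPu hPv
  rw [eQu_eq_sum hk hC]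
  refine abs_sum_mul_chanG_le measurable_pairSignal hC _ ?_ _
  filter_upwards [ae_prod_sphere hPu hPv] with p hp
  filter_upwards [ae_prod_sphere hPu hPv] with q hq
  rw [← overlapU_eq_sum p.1 q.1 p.2 q.2]
  exact abs_overlapU_le hru hq.1 hp.1

lemma abs_eQv_le (hrv : 0 ≤ rv) (hPu : IsUniformSphere nu √(ru * nu) Pu)
    (hPv : IsUniformSphere nv √(rv * nv) Pv) (hk : ∀ k, 0 ≤ pairSnr n nu nv au av t Ru Rv k) :
    |eQv n nu nv au av t Ru Rv Pu Pv| ≤ rv := by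
  have := hPu.1
  have := hPv.1
  obtain ⟨C, -, hC⟩ := exists_abs_pairSignal_le hPu hPv
  rw [eQv_eq_sum hk hC]
  refine abs_sum_mul_chanG_le measurable_pairSignal hC _ ?_ _
  filter_upwards [ae_prod_sphere hPu hPv] with p hp
  filter_upwards [ae_prod_sphere hPu hPv] with q hq
  rw [← overlapV_eq_sum p.1 q.1 p.2 q.2]
  exact abs_overlapU_le hrv hq.2 hp.2

end Overlaps

section Derivative

lemma pairSnr_nonneg {n nu nv : ℕ} {au av t Ru Rv : ℝ} (hau : 0 ≤ au) (hav : 0 ≤ av) (ht : t ≤ 1)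
    (hRu : 0 ≤ Ru) (hRv : 0 ≤ Rv) (k : (Fin nu × Fin nv) ⊕ (Fin nu ⊕ Fin nv)) :
    0 ≤ pairSnr n nu nv au av t Ru Rv k := by
  have := sub_nonneg.2 ht
  rcases k with _ | _ | _ <;> simp only [pairSnr, Sum.elim_inl, Sum.elim_inr] <;> positivity

lemma hasDerivWithinAt_interpFreeEntropy {n nu nv : ℕ} (hn : n ≠ 0) {au av ru rv : ℝ}
    (hau : 0 ≤ au) (hav : 0 ≤ av) {Pu : Measure (Fin nu → ℝ)} {Pv : Measure (Fin nv → ℝ)}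
    (hPu : IsUniformSphere nu √(ru * nu) Pu) (hPv : IsUniformSphere nv √(rv * nv) Pv)
    {Ru Rv : ℝ → ℝ} {Ru' Rv' t : ℝ} (hRu : ∀ s ∈ Icc (0 : ℝ) 1, 0 ≤ Ru s)
    (hRv : ∀ s ∈ Icc (0 : ℝ) 1, 0 ≤ Rv s) (ht : t ∈ Icc (0 : ℝ) 1)
    (hRu' : HasDerivWithinAt Ru Ru' (Icc 0 1) t) (hRv' : HasDerivWithinAt Rv Rv' (Icc 0 1) t) :
    HasDerivWithinAt (fun s => interpFreeEntropy n nu nv au av s (Ru s) (Rv s) Pu Pv)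
      (-(1 / 2) * ((nu : ℝ) / n) * ((nv : ℝ) / n) * eQuQv n nu nv au av t (Ru t) (Rv t) Pu Pv
        + ((nu : ℝ) / n) * (av * Rv' / 2) * eQu n nu nv au av t (Ru t) (Rv t) Pu Pv
        + ((nv : ℝ) / n) * (au * Ru' / 2) * eQv n nu nv au av t (Ru t) (Rv t) Pu Pv)
      (Icc 0 1) t := by
  have := hPu.1
  have := hPv.1
  obtain ⟨C, hC0, hC⟩ := exists_abs_pairSignal_le hPu hPv
  have hk : ∀ s ∈ Icc (0 : ℝ) 1, ∀ k, 0 ≤ pairSnr n nu nv au av s (Ru s) (Rv s) k :=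
    fun s hs => pairSnr_nonneg hau hav hs.2 (hRu s hs) (hRv s hs)
  have h := (hasDerivWithinAt_chanF_sqrt measurable_pairSignal hC hC0
    (lam := fun s => pairSnr n nu nv au av s (Ru s) (Rv s))
    (lam' := Sum.elim (fun _ => -1 / (n : ℝ)) (Sum.elim (fun _ => av * Rv') fun _ => au * Ru'))
    ht hk ?_).const_mul (1 / (n : ℝ))
  · refine (h.congr (fun s hs => interpFreeEntropy_eq_chanF (hk s hs) hC)
      (interpFreeEntropy_eq_chanF (hk t ht) hC)).congr_deriv ?_
    rw [eQuQv_eq_sum (hk t ht) hC, eQu_eq_sum (hk t ht) hC, eQv_eq_sum (hk t ht) hC]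
    change 1 / (n : ℝ) * ∑ k, 1 / 2 * _ * chanG (Pu.prod Pv) pairSignal
      (pairScale n nu nv au av t (Ru t) (Rv t)) k = _
    simp only [Finset.mul_sum, ← Finset.sum_add_distrib]
    refine Finset.sum_congr rfl ?_
    have hn0 : (n : ℝ) ≠ 0 := Nat.cast_ne_zero.2 hn
    rintro (⟨i, j⟩ | i | j) -
    · have h1 : (nu : ℝ) ≠ 0 := Nat.cast_ne_zero.2 i.pos.ne'
      have h2 : (nv : ℝ) ≠ 0 := Nat.cast_ne_zero.2 j.pos.ne'
      simp only [Sum.elim_inl]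
      field_simp
      ring
    · have h1 : (nu : ℝ) ≠ 0 := Nat.cast_ne_zero.2 i.pos.ne'
      simp only [Sum.elim_inl, Sum.elim_inr]
      field_simp
      ring
    · have h2 : (nv : ℝ) ≠ 0 := Nat.cast_ne_zero.2 j.pos.ne'
      simp only [Sum.elim_inr]
      field_simp
      ring
  · rintro (k | i | j)
    · exact ((hasDerivWithinAt_id t _).const_sub 1).div_const _
    · exact hRv'.const_mul av
    · exact hRu'.const_mul au

end Derivative

/-- **Lemma: derivative of the interpolating free entropy.** Along a
continuously differentiable interpolation path `R(·,ε) = (R_u(·,ε), R_v(·,ε))` with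
uniformly bounded derivatives, the derivative in `t` of the average interpolating
free entropy `fₙ(t,ε)` equals exactly
`−(1/2)(n_u/n)(n_v/n) E⟨Q_uQ_v⟩ + (n_u/n)(α_v R'_v/2) E⟨Q_u⟩ + (n_v/n)(α_u R'_u/2) E⟨Q_v⟩`,
and this equals
`−(α_uα_v/2) E⟨(Q_u − R'_u)(Q_v − R'_v)⟩ + (α_uα_v/2) R'_u R'_v + oₙ(1)`
with `oₙ(1)` vanishing uniformly in `(t,ε)` as `n → ∞`. -/
theorem interp_free_entropy_derivative
    (au av ru rv : ℝ) (hau : 0 < au) (hav : 0 < av) (hru : 0 < ru) (hrv : 0 < rv)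
    (nuf nvf : ℕ → ℕ)
    (hnuf : Tendsto (fun n => (nuf n : ℝ) / n) atTop (nhds au))
    (hnvf : Tendsto (fun n => (nvf n : ℝ) / n) atTop (nhds av))
    (Pu : (n : ℕ) → Measure (Fin (nuf n) → ℝ))
    (Pv : (n : ℕ) → Measure (Fin (nvf n) → ℝ))
    (hPu : ∀ n, IsUniformSphere (nuf n) (Real.sqrt (ru * nuf n)) (Pu n))
    (hPv : ∀ n, IsUniformSphere (nvf n) (Real.sqrt (rv * nvf n)) (Pv n))
    (RuP RvP RuP' RvP' : ℝ → ℝ × ℝ → ℝ)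
    (hpos : ∀ t ∈ Icc (0:ℝ) 1, ∀ eps : ℝ × ℝ, 0 ≤ eps.1 → 0 ≤ eps.2 →
      0 ≤ RuP t eps ∧ 0 ≤ RvP t eps)
    (hderiv : ∀ eps : ℝ × ℝ, 0 ≤ eps.1 → 0 ≤ eps.2 → ∀ t ∈ Icc (0:ℝ) 1,
      HasDerivWithinAt (fun s => RuP s eps) (RuP' t eps) (Icc (0:ℝ) 1) t ∧
      HasDerivWithinAt (fun s => RvP s eps) (RvP' t eps) (Icc (0:ℝ) 1) t)
    (hcont : ∀ eps : ℝ × ℝ, 0 ≤ eps.1 → 0 ≤ eps.2 →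
      ContinuousOn (fun t => RuP' t eps) (Icc (0:ℝ) 1) ∧
      ContinuousOn (fun t => RvP' t eps) (Icc (0:ℝ) 1))
    (hbdd : ∃ K : ℝ, ∀ t ∈ Icc (0:ℝ) 1, ∀ eps : ℝ × ℝ, 0 ≤ eps.1 → 0 ≤ eps.2 →
      |RuP' t eps| ≤ K ∧ |RvP' t eps| ≤ K) :
    (∀ n : ℕ, 1 ≤ n → ∀ eps : ℝ × ℝ, 0 ≤ eps.1 → 0 ≤ eps.2 → ∀ t ∈ Icc (0:ℝ) 1,
      HasDerivWithinAt
        (fun s => interpFreeEntropy n (nuf n) (nvf n) au av s (RuP s eps) (RvP s eps)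
          (Pu n) (Pv n))
        (-(1 / 2) * ((nuf n : ℝ) / n) * ((nvf n : ℝ) / n)
            * eQuQv n (nuf n) (nvf n) au av t (RuP t eps) (RvP t eps) (Pu n) (Pv n)
          + ((nuf n : ℝ) / n) * (av * RvP' t eps / 2)
            * eQu n (nuf n) (nvf n) au av t (RuP t eps) (RvP t eps) (Pu n) (Pv n)
          + ((nvf n : ℝ) / n) * (au * RuP' t eps / 2)
            * eQv n (nuf n) (nvf n) au av t (RuP t eps) (RvP t eps) (Pu n) (Pv n))
        (Icc (0:ℝ) 1) t) ∧
    (∃ c : ℕ → ℝ, Tendsto c atTop (nhds 0) ∧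
      ∀ n : ℕ, 1 ≤ n → ∀ eps : ℝ × ℝ, 0 ≤ eps.1 → 0 ≤ eps.2 → ∀ t ∈ Icc (0:ℝ) 1,
        |(-(1 / 2) * ((nuf n : ℝ) / n) * ((nvf n : ℝ) / n)
              * eQuQv n (nuf n) (nvf n) au av t (RuP t eps) (RvP t eps) (Pu n) (Pv n)
            + ((nuf n : ℝ) / n) * (av * RvP' t eps / 2)
              * eQu n (nuf n) (nvf n) au av t (RuP t eps) (RvP t eps) (Pu n) (Pv n)
            + ((nvf n : ℝ) / n) * (au * RuP' t eps / 2)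
              * eQv n (nuf n) (nvf n) au av t (RuP t eps) (RvP t eps) (Pu n) (Pv n))
          - (-(au * av / 2)
              * eCross n (nuf n) (nvf n) au av t (RuP t eps) (RvP t eps)
                  (RuP' t eps) (RvP' t eps) (Pu n) (Pv n)
            + (au * av / 2) * RuP' t eps * RvP' t eps)|
          ≤ c n) := by
  have hnn : ∀ n : ℕ, ∀ eps : ℝ × ℝ, 0 ≤ eps.1 → 0 ≤ eps.2 → ∀ t ∈ Icc (0 : ℝ) 1,
      ∀ k, 0 ≤ pairSnr n (nuf n) (nvf n) au av t (RuP t eps) (RvP t eps) k :=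
    fun n eps h1 h2 t ht => pairSnr_nonneg hau.le hav.le ht.2 (hpos t ht eps h1 h2).1
      (hpos t ht eps h1 h2).2
  refine ⟨fun n hn eps h1 h2 t ht => hasDerivWithinAt_interpFreeEntropy
    (Nat.one_le_iff_ne_zero.1 hn) hau.le hav.le (hPu n) (hPv n)
    (fun s hs => (hpos s hs eps h1 h2).1) (fun s hs => (hpos s hs eps h1 h2).2) ht
    (hderiv eps h1 h2 t ht).1 (hderiv eps h1 h2 t ht).2, ?_⟩
  obtain ⟨K, hK⟩ := hbdd
  refine ⟨fun n => 1 / 2 * |au * av - (nuf n : ℝ) / n * ((nvf n : ℝ) / n)| * (ru * rv)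
    + 1 / 2 * av * K * |(nuf n : ℝ) / n - au| * ru
    + 1 / 2 * au * K * |(nvf n : ℝ) / n - av| * rv, ?_, fun n _ eps h1 h2 t ht => ?_⟩
  · have e1 := (((hnuf.mul hnvf).const_sub (au * av)).abs.const_mul (1 / 2)).mul_const (ru * rv)
    have e2 := ((hnuf.sub_const au).abs.const_mul (1 / 2 * av * K)).mul_const ru
    have e3 := ((hnvf.sub_const av).abs.const_mul (1 / 2 * au * K)).mul_const rv
    simpa using (e1.add e2).add e3
  · have := (hPu n).1
    have := (hPv n).1
    have hk := hnn n eps h1 h2 t ht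
    obtain ⟨C, -, hC⟩ := exists_abs_pairSignal_le (hPu n) (hPv n)
    obtain ⟨hKu, hKv⟩ := hK t ht eps h1 h2
    rw [eCross_eq hk hC]
    have b1 := abs_eQuQv_le hru.le hrv.le (hPu n) (hPv n) hk
    have b2 := abs_eQu_le hru.le (hPu n) (hPv n) hk
    have b3 := abs_eQv_le hrv.le (hPu n) (hPv n) hk
    generalize eQuQv n (nuf n) (nvf n) au av t (RuP t eps) (RvP t eps) (Pu n) (Pv n) = q at *
    generalize eQu n (nuf n) (nvf n) au av t (RuP t eps) (RvP t eps) (Pu n) (Pv n) = qu at *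
    generalize eQv n (nuf n) (nvf n) au av t (RuP t eps) (RvP t eps) (Pu n) (Pv n) = qv at *
    generalize RuP' t eps = a at *
    generalize RvP' t eps = b at *
    have hK0 : 0 ≤ K := (abs_nonneg _).trans hKu
    calc _ = |1 / 2 * (au * av - (nuf n : ℝ) / n * ((nvf n : ℝ) / n)) * q
          + 1 / 2 * av * b * ((nuf n : ℝ) / n - au) * qu
          + 1 / 2 * au * a * ((nvf n : ℝ) / n - av) * qv| := by congr 1; ring
      _ ≤ _ := by
        refine (abs_add_three _ _ _).trans ?_
        simp only [abs_mul, abs_of_pos hau, abs_of_pos hav, abs_of_pos (one_half_pos (α := ℝ))]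
        gcongr

end
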